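/- arXiv:1506.04856 — 3 statements merged into one kernel-verified Lean document; each statement's English description precedes it below -/
import Mathlib

section
/- Let d ≥ 1, −∞ < β < α < ∞ and 0 < q < p < ∞. Then the range of 𝔗_{β→α,p} is contained in the domain of 𝔓_{α,p→q}: every Lévy measure of the form 𝔗_{β→α,p} M with M ∈ 𝔇(𝔗_{β→α,p}) belongs to 𝔇(𝔓_{α,p→q}). -/
open MeasureTheory Set

noncomputable section

variable {E : Type*} [NormedAddCommGroup E] [NormedSpace ℝ E]
  [MeasurableSpace E] [BorelSpace E]

/-- The upsilon transform with dilation measure `ρ` on `(0,∞) ⊆ ℝ`: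
`[Υ_ρ M](B) = ∫ M(s⁻¹ B) ρ(ds)`, realized as the image of `ρ ⊗ M` under `(s, x) ↦ s • x`. -/
def Upsilon (ρ : Measure ℝ) (M : Measure E) : Measure E :=
  Measure.map (fun sx : ℝ × E => sx.1 • sx.2) (ρ.prod M)

/-- `M` is a Lévy measure: σ-finite, no mass at `0`, and `∫ (|x|² ∧ 1) M(dx) < ∞`. -/
def IsLevyMeasure (M : Measure E) : Prop :=
  SigmaFinite M ∧ M {0} = 0 ∧
    ∫⁻ x, ENNReal.ofReal (min (‖x‖ ^ 2) 1) ∂M < ⊤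

/-- The domain `𝔇(Υ_ρ)`: Lévy measures `M` such that `Υ_ρ M` is again a Lévy measure. -/
def UpsilonDomain (ρ : Measure ℝ) : Set (Measure E) :=
  {M | IsLevyMeasure M ∧ IsLevyMeasure (Upsilon ρ M)}

/-- The range `ℜ(Υ_ρ) = {Υ_ρ M : M ∈ 𝔇(Υ_ρ)}`. -/
def UpsilonRange (ρ : Measure ℝ) : Set (Measure E) :=
  Upsilon ρ '' UpsilonDomain (E := E) ρ

/-- The class `𝔐^α`: Borel measures with `M({0}) = 0` and `∫ (|x|² ∧ |x|^α) M(dx) < ∞`. -/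
def MemMAlpha (α : ℝ) (M : Measure E) : Prop :=
  M {0} = 0 ∧ ∫⁻ x, ENNReal.ofReal (min (‖x‖ ^ 2) (‖x‖ ^ α)) ∂M < ⊤

/-- The class `𝔐^log`: Lévy measures with `∫_{|x|>1} log|x| M(dx) < ∞`. -/
def MemMLog (M : Measure E) : Prop :=
  IsLevyMeasure M ∧
    ∫⁻ x in {x : E | 1 < ‖x‖}, ENNReal.ofReal (Real.log ‖x‖) ∂M < ⊤

/-- The dilation measure `ψ_{α,p}(ds) = s^{-α-1} e^{-s^p} 1_{s>0} ds`. -/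
def psiMeasure (α p : ℝ) : Measure ℝ :=
  (volume : Measure ℝ).withDensity fun s =>
    if 0 < s then ENNReal.ofReal (s ^ (-α - 1) * Real.exp (-(s ^ p))) else 0

/-- `K_{α,β,p} = ∫₀^∞ u^{α-β-1} e^{-u^p} du`. -/
def Kconst (α β p : ℝ) : ℝ :=
  ∫ u in Ioi (0 : ℝ), u ^ (α - β - 1) * Real.exp (-(u ^ p))

/-- The dilation measure
`τ_{β→α,p}(ds) = K_{α,β,p}⁻¹ s^{-α-1} (1-s^p)^{(α-β)/p - 1} 1_{0<s<1} ds`. -/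
def tauMeasure (β α p : ℝ) : Measure ℝ :=
  (volume : Measure ℝ).withDensity fun s =>
    if 0 < s ∧ s < 1 then
      ENNReal.ofReal ((Kconst α β p)⁻¹ * (s ^ (-α - 1) * (1 - s ^ p) ^ ((α - β) / p - 1)))
    else 0

/-- `f` is the density of the fully right-skewed `r`-stable distribution on `(0,∞)`:
a nonnegative measurable function with `∫₀^∞ e^{-t x} f(x) dx = e^{-t^r}` for all `t ≥ 0`. -/
def IsStableDensity (r : ℝ) (f : ℝ → ℝ) : Prop :=
  Measurable f ∧ (∀ x, 0 ≤ f x) ∧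
    ∀ t : ℝ, 0 ≤ t →
      ∫ x in Ioi (0 : ℝ), Real.exp (-(t * x)) * f x = Real.exp (-(t ^ r))

/-- The dilation measure `π_{α,p→q}(ds) = p f_{q/p}(s^{-p}) s^{-α-p-1} 1_{s>0} ds`,
where `f` is (to be assumed) the density of the fully right-skewed `q/p`-stable law. -/
def piMeasure (f : ℝ → ℝ) (α p : ℝ) : Measure ℝ :=
  (volume : Measure ℝ).withDensity fun s =>
    if 0 < s then ENNReal.ofReal (p * f (s ^ (-p)) * s ^ (-α - p - 1)) else 0

/-- The measure `ρ(ds) = g(s) 1_{s>0} ds`. -/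
def densMeasure (g : ℝ → ℝ) : Measure ℝ :=
  (volume : Measure ℝ).withDensity fun s => if 0 < s then ENNReal.ofReal (g s) else 0

theorem lintegral_rpow_mul_exp_neg_mul {a x : ℝ} (ha : 0 < a) (hx : 0 < x) :
    ∫⁻ t in Ioi (0 : ℝ), ENNReal.ofReal (t ^ (a - 1) * Real.exp (-(t * x))) =
      ENNReal.ofReal (Real.Gamma a * x ^ (-a)) := by
  have h := Real.integral_rpow_mul_exp_neg_mul_Ioi ha hx
  have hpos : 0 < (1 / x) ^ a * Real.Gamma a :=
    mul_pos (Real.rpow_pos_of_pos (by positivity) _) (Real.Gamma_pos_of_pos ha)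
  have hi : IntegrableOn (fun t : ℝ => t ^ (a - 1) * Real.exp (-(x * t))) (Ioi 0) :=
    .of_integral_ne_zero (by rw [h]; exact hpos.ne')
  simp_rw [mul_comm _ x]
  rw [← ofReal_integral_eq_lintegral_ofReal hi, h]
  · rw [one_div, Real.inv_rpow hx.le, Real.rpow_neg hx.le, mul_comm]
  · filter_upwards [ae_restrict_mem measurableSet_Ioi] with t ht
    have : (0 : ℝ) < t := ht
    positivity

theorem rpow_le_lintegral_one_sub_exp {b x : ℝ} (hb : 0 < b) (hx : 0 < x) :
    ENNReal.ofReal ((1 - Real.exp (-1)) / b * x ^ b) ≤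
      ∫⁻ t in Ioi (0 : ℝ), ENNReal.ofReal (t ^ (-b - 1) * (1 - Real.exp (-(t * x)))) := by
  have he : 0 ≤ 1 - Real.exp (-1) := by
    have := Real.exp_le_one_iff.2 (show (-1 : ℝ) ≤ 0 by norm_num); linarith
  have hx' : 0 < 1 / x := by positivity
  calc ENNReal.ofReal ((1 - Real.exp (-1)) / b * x ^ b)
      = ∫⁻ t in Ioi (1 / x), ENNReal.ofReal ((1 - Real.exp (-1)) * t ^ (-b - 1)) := by
        rw [← ofReal_integral_eq_lintegral_ofReal]
        · rw [integral_const_mul, integral_Ioi_rpow_of_lt (by linarith) hx']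
          congr 1
          rw [sub_add_cancel, one_div, Real.inv_rpow hx.le, Real.rpow_neg hx.le, inv_inv]
          field_simp
        · exact (integrableOn_Ioi_rpow_of_lt (by linarith) hx').const_mul _
        · filter_upwards [ae_restrict_mem measurableSet_Ioi] with t ht
          have : (0 : ℝ) < t := hx'.trans ht
          positivity
    _ ≤ ∫⁻ t in Ioi (1 / x), ENNReal.ofReal (t ^ (-b - 1) * (1 - Real.exp (-(t * x)))) := by
        refine setLIntegral_mono' measurableSet_Ioi fun t ht => ENNReal.ofReal_le_ofReal ?_
        have ht0 : (0 : ℝ) < t := hx'.trans ht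
        have htx : 1 ≤ t * x := by
          have := (div_lt_iff₀ hx).1 ht; linarith
        rw [mul_comm]
        refine mul_le_mul_of_nonneg_left ?_ (Real.rpow_nonneg ht0.le _)
        have := Real.exp_le_exp.2 (neg_le_neg htx)
        linarith
    _ ≤ _ := lintegral_mono_set (Ioi_subset_Ioi hx'.le)

theorem lintegral_rpow_mul_one_sub_exp_rpow_lt_top {r b : ℝ} (hb : 0 < b) (hbr : b < r) :
    ∫⁻ t in Ioi (0 : ℝ), ENNReal.ofReal (t ^ (-b - 1) * (1 - Real.exp (-(t ^ r)))) < ⊤ := by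
  have hsub : Ioi (0 : ℝ) ⊆ Ioo 0 1 ∪ (Ioi 1 ∪ {1}) := by
    intro t ht
    rcases lt_trichotomy t 1 with h | h | h
    · exact Or.inl ⟨ht, h⟩
    · exact Or.inr (Or.inr h)
    · exact Or.inr (Or.inl h)
  refine (lintegral_mono_set hsub).trans_lt ?_
  refine (lintegral_union_le _ _ _).trans_lt (ENNReal.add_lt_top.2 ⟨?_, ?_⟩)
  · have hi : IntegrableOn (fun t : ℝ => t ^ (r - b - 1)) (Ioo 0 1) :=
      (intervalIntegral.integrableOn_Ioo_rpow_iff one_pos).2 (by linarith)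
    refine (setLIntegral_mono' measurableSet_Ioo fun t ht => ENNReal.ofReal_le_ofReal ?_).trans_lt
      hi.lintegral_lt_top
    have h1 : 1 - Real.exp (-(t ^ r)) ≤ t ^ r := by
      have := Real.add_one_le_exp (-(t ^ r)); linarith
    calc t ^ (-b - 1) * (1 - Real.exp (-(t ^ r))) ≤ t ^ (-b - 1) * t ^ r :=
          mul_le_mul_of_nonneg_left h1 (Real.rpow_nonneg ht.1.le _)
      _ = t ^ (r - b - 1) := by rw [← Real.rpow_add ht.1]; congr 1; ring
  · refine (lintegral_union_le _ _ _).trans_lt (ENNReal.add_lt_top.2 ⟨?_, by simp⟩)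
    have hi : IntegrableOn (fun t : ℝ => t ^ (-b - 1)) (Ioi 1) :=
      integrableOn_Ioi_rpow_of_lt (by linarith) one_pos
    refine (setLIntegral_mono' measurableSet_Ioi fun t ht => ENNReal.ofReal_le_ofReal ?_).trans_lt
      hi.lintegral_lt_top
    have ht0 : (0 : ℝ) < t := one_pos.trans ht
    refine mul_le_of_le_one_right (Real.rpow_nonneg ht0.le _) ?_
    linarith [Real.exp_pos (-(t ^ r))]

theorem IsStableDensity.integrableOn_exp_mul {r : ℝ} {f : ℝ → ℝ} (hf : IsStableDensity r f)
    {t : ℝ} (ht : 0 ≤ t) : IntegrableOn (fun x => Real.exp (-(t * x)) * f x) (Ioi 0) :=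
  .of_integral_ne_zero (by rw [hf.2.2 t ht]; exact (Real.exp_pos _).ne')

theorem IsStableDensity.integrableOn {r : ℝ} {f : ℝ → ℝ} (hf : IsStableDensity r f) :
    IntegrableOn f (Ioi 0) := by
  simpa using hf.integrableOn_exp_mul le_rfl

theorem IsStableDensity.integral_eq_one {r : ℝ} (hr : 0 < r) {f : ℝ → ℝ}
    (hf : IsStableDensity r f) : ∫ x in Ioi (0 : ℝ), f x = 1 := by
  simpa [Real.zero_rpow hr.ne'] using hf.2.2 0 le_rfl

theorem IsStableDensity.lintegral_exp_mul {r : ℝ} {f : ℝ → ℝ} (hf : IsStableDensity r f)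
    {t : ℝ} (ht : 0 ≤ t) :
    ∫⁻ x in Ioi (0 : ℝ), ENNReal.ofReal (Real.exp (-(t * x)) * f x) =
      ENNReal.ofReal (Real.exp (-(t ^ r))) := by
  rw [← ofReal_integral_eq_lintegral_ofReal (hf.integrableOn_exp_mul ht), hf.2.2 t ht]
  exact ae_of_all _ fun x => mul_nonneg (Real.exp_pos _).le (hf.2.1 x)

theorem IsStableDensity.lintegral_one_sub_exp_mul {r : ℝ} (hr : 0 < r) {f : ℝ → ℝ}
    (hf : IsStableDensity r f) {t : ℝ} (ht : 0 ≤ t) :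
    ∫⁻ x in Ioi (0 : ℝ), ENNReal.ofReal ((1 - Real.exp (-(t * x))) * f x) =
      ENNReal.ofReal (1 - Real.exp (-(t ^ r))) := by
  have hi : IntegrableOn (fun x => (1 - Real.exp (-(t * x))) * f x) (Ioi 0) := by
    simp_rw [sub_mul, one_mul]
    exact hf.integrableOn.sub (hf.integrableOn_exp_mul ht)
  rw [← ofReal_integral_eq_lintegral_ofReal hi]
  · simp_rw [sub_mul, one_mul]
    rw [integral_sub hf.integrableOn (hf.integrableOn_exp_mul ht), hf.integral_eq_one hr,
      hf.2.2 t ht]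
  · filter_upwards [ae_restrict_mem measurableSet_Ioi] with x hx
    refine mul_nonneg ?_ (hf.2.1 x)
    have := Real.exp_le_one_iff.2 (neg_nonpos.2 (mul_nonneg ht (le_of_lt hx)))
    linarith

/-- If `c * x ^ b` is dominated by `∫ w t * k t x dt` and the latter
has finite `f`-integral after exchanging the integrals, then the `b`-th moment of `f` is finite. -/
theorem integrableOn_rpow_mul_of_lintegral_kernel {f : ℝ → ℝ} (hfm : Measurable f)
    (hf0 : ∀ x, 0 ≤ f x) {b c : ℝ} (hc : 0 < c) {w : ℝ → ℝ} {k : ℝ → ℝ → ℝ}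
    (hw : Measurable w) (hw0 : ∀ t, 0 < t → 0 ≤ w t) (hk : Measurable (Function.uncurry k))
    (hle : ∀ x, 0 < x →
      ENNReal.ofReal (c * x ^ b) ≤ ∫⁻ t in Ioi (0 : ℝ), ENNReal.ofReal (w t * k t x))
    (hfin : ∫⁻ t in Ioi (0 : ℝ), ENNReal.ofReal (w t) *
      ∫⁻ x in Ioi (0 : ℝ), ENNReal.ofReal (k t x * f x) < ⊤) :
    IntegrableOn (fun x => x ^ b * f x) (Ioi 0) := by
  have hkx : ∀ x, Measurable fun t => k t x := fun x => hk.of_uncurry_right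
  have hkt : ∀ t, Measurable fun x => k t x := fun t => hk.of_uncurry_left
  have hb : Measurable fun x : ℝ => x ^ b := by fun_prop
  refine ⟨(hb.mul hfm).aestronglyMeasurable, ?_⟩
  rw [hasFiniteIntegral_iff_ofReal]
  swap
  · filter_upwards [ae_restrict_mem measurableSet_Ioi] with x hx
    exact mul_nonneg (Real.rpow_nonneg (le_of_lt hx) _) (hf0 x)
  have key : ENNReal.ofReal c * ∫⁻ x in Ioi (0 : ℝ), ENNReal.ofReal (x ^ b * f x) < ⊤ := by
    refine lt_of_le_of_lt ?_ hfin
    calc ENNReal.ofReal c * ∫⁻ x in Ioi (0 : ℝ), ENNReal.ofReal (x ^ b * f x)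
        = ∫⁻ x in Ioi (0 : ℝ), ENNReal.ofReal c * ENNReal.ofReal (x ^ b * f x) :=
          (lintegral_const_mul _ (by fun_prop)).symm
      _ ≤ ∫⁻ x in Ioi (0 : ℝ), ∫⁻ t in Ioi (0 : ℝ),
            ENNReal.ofReal (w t) * ENNReal.ofReal (k t x * f x) := by
          refine setLIntegral_mono' measurableSet_Ioi fun x hx => ?_
          have hwk : Measurable fun t => w t * k t x := hw.mul (hkx x)
          have : ∀ t ∈ Ioi (0 : ℝ), ENNReal.ofReal (w t) * ENNReal.ofReal (k t x * f x) =
              ENNReal.ofReal (w t * k t x) * ENNReal.ofReal (f x) := fun t ht => by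
            rw [← ENNReal.ofReal_mul (hw0 t ht), ← mul_assoc, ENNReal.ofReal_mul' (hf0 x)]
          rw [setLIntegral_congr_fun measurableSet_Ioi this,
            lintegral_mul_const _ hwk.ennreal_ofReal,
            ← ENNReal.ofReal_mul hc.le, ← mul_assoc, ENNReal.ofReal_mul' (hf0 x)]
          gcongr
          exact hle x hx
      _ = ∫⁻ t in Ioi (0 : ℝ), ∫⁻ x in Ioi (0 : ℝ),
            ENNReal.ofReal (w t) * ENNReal.ofReal (k t x * f x) := by
          refine lintegral_lintegral_swap (Measurable.aemeasurable ?_)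
          refine (hw.comp measurable_snd).ennreal_ofReal.mul (Measurable.ennreal_ofReal ?_)
          exact (hk.comp measurable_swap).mul (hfm.comp measurable_fst)
      _ = _ := by
          refine lintegral_congr fun t => ?_
          exact lintegral_const_mul _ ((hkt t).mul hfm).ennreal_ofReal
  exact ENNReal.lt_top_of_mul_ne_top_right key.ne (ENNReal.ofReal_pos.2 hc).ne'

theorem IsStableDensity.integrableOn_rpow_mul {r : ℝ} (hr : 0 < r) {f : ℝ → ℝ}
    (hf : IsStableDensity r f) {b : ℝ} (hbr : b < r) :
    IntegrableOn (fun x => x ^ b * f x) (Ioi 0) := by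
  rcases lt_trichotomy b 0 with hb | rfl | hb
  · refine integrableOn_rpow_mul_of_lintegral_kernel hf.1 hf.2.1
      (Real.Gamma_pos_of_pos (neg_pos.2 hb)) (w := fun t => t ^ (-b - 1))
      (k := fun t x => Real.exp (-(t * x))) (by fun_prop)
      (fun t ht => Real.rpow_nonneg ht.le _) (by fun_prop) (fun x hx => ?_) ?_
    · rw [lintegral_rpow_mul_exp_neg_mul (neg_pos.2 hb) hx, neg_neg]
    · have hval := integral_rpow_mul_exp_neg_rpow (p := r) (q := -b - 1) hr (by linarith)
      have hi : IntegrableOn (fun t : ℝ => t ^ (-b - 1) * Real.exp (-(t ^ r))) (Ioi 0) := by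
        refine .of_integral_ne_zero ?_
        rw [hval]
        have : 0 < Real.Gamma ((-b - 1 + 1) / r) :=
          Real.Gamma_pos_of_pos (div_pos (by linarith) hr)
        positivity
      refine lt_of_le_of_lt (le_of_eq ?_) hi.lintegral_lt_top
      refine setLIntegral_congr_fun measurableSet_Ioi fun t ht => ?_
      have ht0 : (0 : ℝ) < t := ht
      rw [hf.lintegral_exp_mul ht0.le, ← ENNReal.ofReal_mul (by positivity)]
  · simpa using hf.integrableOn
  · have he : 0 < 1 - Real.exp (-1) := sub_pos.2 (by simp)
    refine integrableOn_rpow_mul_of_lintegral_kernel hf.1 hf.2.1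
      (div_pos he hb) (w := fun t => t ^ (-b - 1))
      (k := fun t x => 1 - Real.exp (-(t * x))) (by fun_prop)
      (fun t ht => Real.rpow_nonneg ht.le _) (by fun_prop)
      (fun x hx => rpow_le_lintegral_one_sub_exp hb hx) ?_
    refine lt_of_le_of_lt (le_of_eq ?_) (lintegral_rpow_mul_one_sub_exp_rpow_lt_top hb hbr)
    refine setLIntegral_congr_fun measurableSet_Ioi fun t ht => ?_
    have ht0 : (0 : ℝ) < t := ht
    rw [hf.lintegral_one_sub_exp_mul hr ht0.le, ← ENNReal.ofReal_mul (by positivity)]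

theorem piMeasure_eq (f : ℝ → ℝ) (α p : ℝ) :
    piMeasure f α p = (volume.restrict (Ioi 0)).withDensity fun s =>
      ENNReal.ofReal (p * f (s ^ (-p)) * s ^ (-α - p - 1)) := by
  rw [← withDensity_indicator measurableSet_Ioi]
  rfl

theorem lintegral_piMeasure_rpow_lt_top {q p α γ : ℝ} (hq : 0 < q) (hp : 0 < p) {f : ℝ → ℝ}
    (hf : IsStableDensity (q / p) f) (hγ : α - q < γ) :
    ∫⁻ u, ENNReal.ofReal (|u| ^ γ) ∂piMeasure f α p < ⊤ := by
  have hint := hf.integrableOn_rpow_mul (div_pos hq hp) (b := (α - γ) / p)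
    (div_lt_div_of_pos_right (by linarith) hp)
  rw [← integrableOn_Ioi_comp_rpow_iff _ (neg_ne_zero.2 hp.ne')] at hint
  have hfm : Measurable fun s : ℝ => ENNReal.ofReal (p * f (s ^ (-p)) * s ^ (-α - p - 1)) := by
    have := hf.1
    fun_prop
  rw [piMeasure_eq, lintegral_withDensity_eq_lintegral_mul _ hfm (by fun_prop)]
  refine lt_of_le_of_lt (le_of_eq ?_) hint.lintegral_lt_top
  refine setLIntegral_congr_fun measurableSet_Ioi fun s hs => ?_
  have hs0 : (0 : ℝ) < s := hs
  have hfs := hf.2.1 (s ^ (-p))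
  rw [Pi.mul_apply, ← ENNReal.ofReal_mul (by positivity), abs_of_pos hs0, abs_neg,
    abs_of_pos hp, smul_eq_mul, ← Real.rpow_mul hs0.le]
  congr 1
  have h1 : s ^ (-α - p - 1) * s ^ γ = s ^ (-p - 1) * s ^ (-p * ((α - γ) / p)) := by
    rw [← Real.rpow_add hs0, ← Real.rpow_add hs0]
    congr 1
    field_simp
    ring
  calc _ = p * f (s ^ (-p)) * (s ^ (-α - p - 1) * s ^ γ) := by ring
    _ = _ := by rw [h1]; ring

theorem min_sq_one_le_rpow {γ a : ℝ} (hγ0 : 0 ≤ γ) (hγ2 : γ ≤ 2) (ha : 0 ≤ a) :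
    min (a ^ 2) 1 ≤ a ^ γ := by
  rcases le_total a 1 with h | h
  · rcases ha.eq_or_lt with rfl | ha
    · simpa using Real.rpow_nonneg le_rfl γ
    · refine (min_le_left _ _).trans ?_
      rw [← Real.rpow_two]
      exact Real.rpow_le_rpow_of_exponent_ge ha h hγ2
  · exact (min_le_right _ _).trans (Real.one_le_rpow h hγ0)

/-- The Lévy integral of `Υ_ρ` applied to a point mass is dominated through moments of `ρ`. -/
theorem lintegral_min_smul_le {γ : ℝ} {F : Type*} [NormedAddCommGroup F] [NormedSpace ℝ F]
    (hγ0 : 0 ≤ γ) (hγ2 : γ ≤ 2) (ρ : Measure ℝ) (y : F) :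
    ∫⁻ u, ENNReal.ofReal (min (‖u • y‖ ^ 2) 1) ∂ρ ≤
      (∫⁻ u, ENNReal.ofReal (|u| ^ (2 : ℝ)) ∂ρ + ∫⁻ u, ENNReal.ofReal (|u| ^ γ) ∂ρ) *
        (ENNReal.ofReal (min (‖y‖ ^ 2) 1) +
          {y : F | 1 < ‖y‖}.indicator (fun y => ENNReal.ofReal (‖y‖ ^ γ)) y) := by
  have main : ∀ δ : ℝ, 0 ≤ δ → δ ≤ 2 → ∫⁻ u, ENNReal.ofReal (min (‖u • y‖ ^ 2) 1) ∂ρ ≤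
      (∫⁻ u, ENNReal.ofReal (|u| ^ δ) ∂ρ) * ENNReal.ofReal (‖y‖ ^ δ) := fun δ h0 h2 => by
    rw [← lintegral_mul_const _ (by fun_prop)]
    refine lintegral_mono fun u => ?_
    rw [← ENNReal.ofReal_mul (by positivity), ← Real.mul_rpow (abs_nonneg _) (norm_nonneg _),
      norm_smul, Real.norm_eq_abs]
    exact ENNReal.ofReal_le_ofReal (min_sq_one_le_rpow h0 h2 (by positivity))
  rcases le_or_gt ‖y‖ 1 with h | h
  · refine (main 2 zero_le_two le_rfl).trans ?_
    refine mul_le_mul' le_self_add (le_trans (ENNReal.ofReal_le_ofReal ?_) le_self_add)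
    rw [Real.rpow_two]
    exact le_min le_rfl (by nlinarith [norm_nonneg y])
  · refine (main γ hγ0 hγ2).trans ?_
    refine mul_le_mul' le_add_self (le_trans (le_of_eq ?_) le_add_self)
    rw [indicator_of_mem (show y ∈ {y : F | 1 < ‖y‖} from h)]

theorem sigmaFinite_of_lintegral_min_lt_top {F : Type*} [NormedAddCommGroup F]
    [MeasurableSpace F] [BorelSpace F] {N : Measure F} (h0 : N {0} = 0)
    (h : ∫⁻ x, ENNReal.ofReal (min (‖x‖ ^ 2) 1) ∂N < ⊤) : SigmaFinite N := by
  have hm : Measurable fun x : F => ENNReal.ofReal (min (‖x‖ ^ 2) 1) := by fun_prop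
  have hne : ∀ᵐ x ∂N, ENNReal.ofReal (min (‖x‖ ^ 2) 1) ≠ 0 := by
    rw [ae_iff]
    refine measure_mono_null (fun x hx => ?_) h0
    by_contra hx0
    have : 0 < ‖x‖ := norm_pos_iff.2 hx0
    have : 0 < min (‖x‖ ^ 2) 1 := by positivity
    exact hx (ENNReal.ofReal_pos.2 this).ne'
  have : IsFiniteMeasure (N.withDensity fun x : F => ENNReal.ofReal (min (‖x‖ ^ 2) 1)) :=
    isFiniteMeasure_withDensity h.ne
  rw [← withDensity_inv_same hm hne (ae_of_all _ fun _ => ENNReal.ofReal_ne_top)]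
  refine SigmaFinite.withDensity_of_ne_top ?_
  exact (withDensity_absolutelyContinuous _ _).ae_le
    (hne.mono fun x hx => ENNReal.inv_ne_top.2 hx)

section

variable [SecondCountableTopology E]

theorem lintegral_upsilon (ρ : Measure ℝ) [SFinite ρ] (M : Measure E) [SFinite M]
    {g : E → ENNReal} (hg : Measurable g) :
    ∫⁻ y, g y ∂Upsilon ρ M = ∫⁻ x, ∫⁻ s, g (s • x) ∂ρ ∂M := by
  have hs : Measurable fun sx : ℝ × E => sx.1 • sx.2 := by fun_prop
  rw [Upsilon, lintegral_map hg hs, lintegral_prod_symm]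
  exact (hg.comp hs).aemeasurable

theorem upsilon_singleton_zero {ρ : Measure ℝ} [SFinite ρ] (hρ : ρ {0} = 0) {M : Measure E}
    [SFinite M] (hM : M {0} = 0) : Upsilon ρ M {0} = 0 := by
  have hs : Measurable fun sx : ℝ × E => sx.1 • sx.2 := by fun_prop
  rw [Upsilon, Measure.map_apply hs (measurableSet_singleton 0)]
  refine measure_mono_null (t := {0} ×ˢ univ ∪ univ ×ˢ {0}) (fun sx h => ?_) ?_
  · simpa [smul_eq_zero] using h
  · rw [measure_union_null_iff, Measure.prod_prod, Measure.prod_prod, hρ, hM]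
    simp

theorem isLevyMeasure_upsilon {ρ : Measure ℝ} [SFinite ρ] (hρ : ρ {0} = 0) {M : Measure E}
    [SFinite M] (hM : M {0} = 0)
    (h : ∫⁻ x, ∫⁻ s, ENNReal.ofReal (min (‖s • x‖ ^ 2) 1) ∂ρ ∂M < ⊤) :
    IsLevyMeasure (Upsilon ρ M) := by
  have h0 := upsilon_singleton_zero hρ hM
  have hfin : ∫⁻ y, ENNReal.ofReal (min (‖y‖ ^ 2) 1) ∂Upsilon ρ M < ⊤ := by
    rwa [lintegral_upsilon ρ M (by fun_prop)]
  exact ⟨sigmaFinite_of_lintegral_min_lt_top h0 hfin, h0, hfin⟩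

theorem isLevyMeasure_upsilon_of_moment {ρ : Measure ℝ} [SFinite ρ] (hρ : ρ {0} = 0) {γ : ℝ}
    (hγ0 : 0 ≤ γ) (hγ2 : γ ≤ 2) (h2 : ∫⁻ u, ENNReal.ofReal (|u| ^ (2 : ℝ)) ∂ρ < ⊤)
    (hγ : ∫⁻ u, ENNReal.ofReal (|u| ^ γ) ∂ρ < ⊤) {N : Measure E} (hN : IsLevyMeasure N)
    (hNγ : ∫⁻ y in {y : E | 1 < ‖y‖}, ENNReal.ofReal (‖y‖ ^ γ) ∂N < ⊤) :
    IsLevyMeasure (Upsilon ρ N) := by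
  obtain ⟨hσ, h0, hfin⟩ := hN
  have hS : MeasurableSet {y : E | 1 < ‖y‖} := measurableSet_lt measurable_const measurable_norm
  refine isLevyMeasure_upsilon hρ h0 ((lintegral_mono (lintegral_min_smul_le hγ0 hγ2 ρ)).trans_lt ?_)
  have hind : Measurable ({y : E | 1 < ‖y‖}.indicator fun y => ENNReal.ofReal (‖y‖ ^ γ)) :=
    Measurable.indicator (by fun_prop) hS
  rw [lintegral_const_mul _ (Measurable.fun_add (by fun_prop) hind),
    lintegral_add_left (by fun_prop), lintegral_indicator hS]
  exact ENNReal.mul_lt_top (ENNReal.add_lt_top.2 ⟨h2, hγ⟩) (ENNReal.add_lt_top.2 ⟨hfin, hNγ⟩)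

end

theorem Kconst_pos {α β p : ℝ} (h : β < α) (hp : 0 < p) : 0 < Kconst α β p := by
  rw [Kconst, integral_rpow_mul_exp_neg_rpow hp (by linarith)]
  have : 0 < Real.Gamma ((α - β - 1 + 1) / p) :=
    Real.Gamma_pos_of_pos (div_pos (by linarith) hp)
  positivity

theorem tauMeasure_eq (β α p : ℝ) :
    tauMeasure β α p = (volume.restrict (Ioo 0 1)).withDensity fun s =>
      ENNReal.ofReal ((Kconst α β p)⁻¹ * (s ^ (-α - 1) * (1 - s ^ p) ^ ((α - β) / p - 1))) := by
  rw [← withDensity_indicator measurableSet_Ioo, tauMeasure]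
  congr 1
  ext s
  simp only [indicator, mem_Ioo]

theorem ae_tauMeasure_mem_Ioo (β α p : ℝ) : ∀ᵐ s ∂tauMeasure β α p, s ∈ Ioo (0 : ℝ) 1 := by
  rw [tauMeasure_eq]
  exact (withDensity_absolutelyContinuous _ _).ae_le (ae_restrict_mem measurableSet_Ioo)

theorem exists_one_sub_rpow_bounds {p : ℝ} (hp : 0 < p) (e : ℝ) :
    ∃ c C : ℝ, 0 < c ∧ 0 < C ∧
      ∀ s ∈ Ioo (0 : ℝ) (1 / 2), c ≤ (1 - s ^ p) ^ e ∧ (1 - s ^ p) ^ e ≤ C := by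
  have hm : (0 : ℝ) < 1 - (1 / 2) ^ p :=
    sub_pos.2 (Real.rpow_lt_one (by norm_num) (by norm_num) hp)
  have hs : ∀ s ∈ Ioo (0 : ℝ) (1 / 2), 1 - (1 / 2) ^ p ≤ 1 - s ^ p ∧ 1 - s ^ p ≤ 1 := by
    intro s hs
    have h1 := Real.rpow_le_rpow hs.1.le hs.2.le hp.le
    have h2 := Real.rpow_nonneg hs.1.le p
    constructor <;> linarith
  rcases le_total 0 e with he | he
  · refine ⟨(1 - (1 / 2) ^ p) ^ e, 1, Real.rpow_pos_of_pos hm _, one_pos, fun s h => ?_⟩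
    obtain ⟨h1, h2⟩ := hs s h
    exact ⟨Real.rpow_le_rpow hm.le h1 he, Real.rpow_le_one (hm.le.trans h1) h2 he⟩
  · refine ⟨1, (1 - (1 / 2) ^ p) ^ e, one_pos, Real.rpow_pos_of_pos hm _, fun s h => ?_⟩
    obtain ⟨h1, h2⟩ := hs s h
    exact ⟨Real.one_le_rpow_of_pos_of_le_one_of_nonpos (hm.trans_le h1) h2 he,
      Real.rpow_le_rpow_of_nonpos hm h1 he⟩

/-- Away from `s = 1` the dilation measure of `𝔗_{β→α,p}` is comparable to `s^{-α-1} ds`. -/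
theorem exists_tauMeasure_bounds {α β p : ℝ} (h : β < α) (hp : 0 < p) :
    ∃ c C : ℝ, 0 < c ∧ 0 < C ∧ ∀ g : ℝ → ENNReal, Measurable g →
      ENNReal.ofReal c * ∫⁻ s in Ioo (0 : ℝ) (1 / 2), ENNReal.ofReal (s ^ (-α - 1)) * g s ≤
        ∫⁻ s in Ioo (0 : ℝ) (1 / 2), g s ∂tauMeasure β α p ∧
      ∫⁻ s in Ioo (0 : ℝ) (1 / 2), g s ∂tauMeasure β α p ≤
        ENNReal.ofReal C * ∫⁻ s in Ioo (0 : ℝ) (1 / 2), ENNReal.ofReal (s ^ (-α - 1)) * g s := by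
  obtain ⟨c, C, hc, hC, hb⟩ := exists_one_sub_rpow_bounds hp ((α - β) / p - 1)
  have hK : 0 < (Kconst α β p)⁻¹ := inv_pos.2 (Kconst_pos h hp)
  refine ⟨(Kconst α β p)⁻¹ * c, (Kconst α β p)⁻¹ * C, by positivity, by positivity,
    fun g hg => ?_⟩
  have hsub : Ioo (0 : ℝ) (1 / 2) ⊆ Ioo 0 1 := Ioo_subset_Ioo le_rfl (by norm_num)
  have heq : ∫⁻ s in Ioo (0 : ℝ) (1 / 2), g s ∂tauMeasure β α p =
      ∫⁻ s in Ioo (0 : ℝ) (1 / 2), ENNReal.ofReal ((Kconst α β p)⁻¹ *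
        (s ^ (-α - 1) * (1 - s ^ p) ^ ((α - β) / p - 1))) * g s := by
    rw [tauMeasure_eq, restrict_withDensity measurableSet_Ioo,
      Measure.restrict_restrict measurableSet_Ioo, inter_eq_left.2 hsub,
      lintegral_withDensity_eq_lintegral_mul _ (by fun_prop) hg]
    rfl
  rw [heq, ← lintegral_const_mul _ (by fun_prop), ← lintegral_const_mul _ (by fun_prop)]
  have hmul : ∀ s x : ℝ, 0 ≤ x → ENNReal.ofReal ((Kconst α β p)⁻¹ * x) *
      (ENNReal.ofReal (s ^ (-α - 1)) * g s) =
        ENNReal.ofReal ((Kconst α β p)⁻¹ * (s ^ (-α - 1) * x)) * g s := fun s x hx => by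
    rw [← mul_assoc, ← ENNReal.ofReal_mul (by positivity), mul_assoc, mul_comm x]
  constructor <;> refine setLIntegral_mono' measurableSet_Ioo fun s hs => ?_ <;>
    have hs0 : 0 ≤ s ^ (-α - 1) := Real.rpow_nonneg hs.1.le _
  · rw [hmul s c hc.le]
    gcongr
    exact (hb s hs).1
  · rw [hmul s C hC.le]
    gcongr
    exact (hb s hs).2

theorem lintegral_sq_tauMeasure_lt_top {α β p : ℝ} {F : Type*} [NormedAddCommGroup F]
    [NormedSpace ℝ F] {x : F} (hx : x ≠ 0)
    (h : ∫⁻ s, ENNReal.ofReal (min (‖s • x‖ ^ 2) 1) ∂tauMeasure β α p < ⊤) :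
    ∫⁻ s, ENNReal.ofReal (s ^ 2) ∂tauMeasure β α p < ⊤ := by
  have hx0 : 0 < ‖x‖ := norm_pos_iff.2 hx
  have hr : 0 < min (‖x‖ ^ 2) 1 := by positivity
  have key : ENNReal.ofReal (min (‖x‖ ^ 2) 1) * ∫⁻ s, ENNReal.ofReal (s ^ 2) ∂tauMeasure β α p
      < ⊤ := by
    refine lt_of_le_of_lt ?_ h
    rw [← lintegral_const_mul _ (by fun_prop)]
    refine lintegral_mono_ae ((ae_tauMeasure_mem_Ioo β α p).mono fun s hs => ?_)
    rw [← ENNReal.ofReal_mul hr.le]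
    refine ENNReal.ofReal_le_ofReal ?_
    have hs2 : s ^ 2 ≤ 1 := by nlinarith [hs.1, hs.2]
    rw [norm_smul, mul_pow, Real.norm_eq_abs, sq_abs]
    refine le_min ?_ ?_
    · rw [mul_comm]
      exact mul_le_mul_of_nonneg_left (min_le_left _ _) (sq_nonneg s)
    · exact mul_le_one₀ (min_le_right _ _) (sq_nonneg s) hs2
  exact ENNReal.lt_top_of_mul_ne_top_right key.ne (ENNReal.ofReal_pos.2 hr).ne'

theorem lt_two_of_lintegral_sq_tauMeasure_lt_top {α β p : ℝ} (hβα : β < α) (hp : 0 < p)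
    (h : ∫⁻ s, ENNReal.ofReal (s ^ 2) ∂tauMeasure β α p < ⊤) : α < 2 := by
  obtain ⟨c, C, hc, -, hb⟩ := exists_tauMeasure_bounds hβα hp
  have h1 := ((hb (fun s => ENNReal.ofReal (s ^ 2)) (by fun_prop)).1.trans
    (setLIntegral_le_lintegral _ _)).trans_lt h
  have h2 : ∫⁻ s in Ioo (0 : ℝ) (1 / 2), ENNReal.ofReal (s ^ (-α - 1)) * ENNReal.ofReal (s ^ 2) < ⊤ :=
    ENNReal.lt_top_of_mul_ne_top_right h1.ne (ENNReal.ofReal_pos.2 hc).ne'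
  have h3 : IntegrableOn (fun s : ℝ => s ^ (1 - α)) (Ioo 0 (1 / 2)) := by
    refine ⟨Measurable.aestronglyMeasurable (by fun_prop), ?_⟩
    rw [hasFiniteIntegral_iff_ofReal]
    · refine lt_of_le_of_lt (le_of_eq ?_) h2
      refine setLIntegral_congr_fun measurableSet_Ioo fun s hs => ?_
      rw [← ENNReal.ofReal_mul (Real.rpow_nonneg hs.1.le _), ← Real.rpow_two,
        ← Real.rpow_add hs.1]
      congr 2
      ring
    · filter_upwards [ae_restrict_mem measurableSet_Ioo] with s hs
      exact Real.rpow_nonneg hs.1.le _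
  linarith [(intervalIntegral.integrableOn_Ioo_rpow_iff (by norm_num)).1 h3]

theorem tauMeasure_Ico_lt_top {α β p : ℝ}
    (h : ∫⁻ s, ENNReal.ofReal (s ^ 2) ∂tauMeasure β α p < ⊤) :
    tauMeasure β α p (Ico (1 / 2) 1) < ⊤ := by
  have h1 : ENNReal.ofReal (1 / 4) * tauMeasure β α p (Ico (1 / 2) 1) < ⊤ := by
    refine lt_of_le_of_lt ?_ h
    rw [← setLIntegral_const]
    refine (setLIntegral_mono' measurableSet_Ico fun s hs => ENNReal.ofReal_le_ofReal ?_).trans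
      (setLIntegral_le_lintegral _ _)
    nlinarith [hs.1]
  exact ENNReal.lt_top_of_mul_ne_top_right h1.ne (by simp)

theorem lintegral_tauMeasure_tail_le {α β p γ R C : ℝ} (hγ0 : 0 ≤ γ) (hγα : γ < α)
    (hR : 1 < R) (hC : 0 < C)
    (hb : ∀ g : ℝ → ENNReal, Measurable g →
      ∫⁻ s in Ioo (0 : ℝ) (1 / 2), g s ∂tauMeasure β α p ≤
        ENNReal.ofReal C * ∫⁻ s in Ioo (0 : ℝ) (1 / 2), ENNReal.ofReal (s ^ (-α - 1)) * g s) :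
    ∫⁻ s, (Ioi (1 / R)).indicator (fun s => ENNReal.ofReal ((|s| * R) ^ γ)) s
        ∂tauMeasure β α p ≤
      (ENNReal.ofReal (C / (α - γ)) + tauMeasure β α p (Ico (1 / 2) 1)) *
        ENNReal.ofReal (R ^ α) := by
  have hR0 : 0 < R := one_pos.trans hR
  set G : ℝ → ENNReal := (Ioi (1 / R)).indicator fun s => ENNReal.ofReal ((|s| * R) ^ γ)
  have hG : Measurable G := Measurable.indicator (by fun_prop) measurableSet_Ioi
  have hsplit : ∫⁻ s, G s ∂tauMeasure β α p ≤
      ∫⁻ s in Ioo (0 : ℝ) (1 / 2), G s ∂tauMeasure β α p +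
        ∫⁻ s in Ico (1 / 2 : ℝ) 1, G s ∂tauMeasure β α p := by
    refine le_trans ?_ (lintegral_union_le _ _ _)
    rw [Measure.restrict_eq_self_of_ae_mem]
    filter_upwards [ae_tauMeasure_mem_Ioo β α p] with s hs
    exact (lt_or_ge s (1 / 2)).imp (fun h => ⟨hs.1, h⟩) fun h => ⟨h, hs.2⟩
  refine hsplit.trans ?_
  rw [add_mul]
  refine add_le_add ((hb G hG).trans ?_) ?_
  · have hint := integrableOn_Ioi_rpow_of_lt (show γ - α - 1 < -1 by linarith)
      (show 0 < 1 / R by positivity)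
    have hle : ∫⁻ s in Ioo (0 : ℝ) (1 / 2), ENNReal.ofReal (s ^ (-α - 1)) * G s ≤
        ∫⁻ s in Ioi (1 / R), ENNReal.ofReal (R ^ γ * s ^ (γ - α - 1)) := by
      rw [← lintegral_indicator measurableSet_Ioi]
      refine (setLIntegral_mono' measurableSet_Ioo fun s hs => ?_).trans
        (setLIntegral_le_lintegral _ _)
      by_cases hsR : s ∈ Ioi (1 / R)
      · have hs0 := hs.1
        simp only [G, indicator_of_mem hsR]
        rw [← ENNReal.ofReal_mul (by positivity), abs_of_pos hs0,
          Real.mul_rpow hs0.le hR0.le, ← mul_assoc, ← Real.rpow_add hs0, mul_comm]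
        refine le_of_eq ?_
        congr 3
        ring
      · simp only [G, indicator_of_notMem hsR, mul_zero, le_refl]
    refine (mul_le_mul' le_rfl hle).trans (le_of_eq ?_)
    rw [← ofReal_integral_eq_lintegral_ofReal (hint.const_mul _), integral_const_mul,
      integral_Ioi_rpow_of_lt (by linarith) (by positivity), ← ENNReal.ofReal_mul hC.le,
      ← ENNReal.ofReal_mul (by have := sub_pos.2 hγα; positivity)]
    · congr 1
      have h1 : R ^ γ * (1 / R) ^ (γ - α - 1 + 1) = R ^ α := by
        rw [one_div, Real.inv_rpow hR0.le, ← Real.rpow_neg hR0.le, ← Real.rpow_add hR0]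
        congr 1
        ring
      rw [← h1]
      have h2 : α - γ ≠ 0 := (sub_pos.2 hγα).ne'
      have h3 : γ - α - 1 + 1 ≠ 0 := by
        intro h; apply h2; linarith
      field_simp
      ring
    · filter_upwards [ae_restrict_mem measurableSet_Ioi] with s hs
      have : 0 < s := lt_trans (by positivity) hs
      positivity
  · rw [mul_comm, ← setLIntegral_const]
    refine setLIntegral_mono' measurableSet_Ico fun s hs => ?_
    refine (indicator_le_self _ _ s).trans (ENNReal.ofReal_le_ofReal ?_)
    have hs0 : 0 < s := lt_of_lt_of_le (by norm_num) hs.1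
    rw [abs_of_pos hs0]
    calc (s * R) ^ γ ≤ R ^ γ :=
          Real.rpow_le_rpow (by positivity) (by nlinarith [hs.2]) hγ0
      _ ≤ R ^ α := Real.rpow_le_rpow_of_exponent_le hR.le hγα.le

theorem le_lintegral_tauMeasure_min {α β p R c : ℝ} (hα2 : α < 2) (hR : 1 < R) (hc : 0 < c)
    (hb : ∀ g : ℝ → ENNReal, Measurable g →
      ENNReal.ofReal c * ∫⁻ s in Ioo (0 : ℝ) (1 / 2), ENNReal.ofReal (s ^ (-α - 1)) * g s ≤
        ∫⁻ s in Ioo (0 : ℝ) (1 / 2), g s ∂tauMeasure β α p) :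
    ENNReal.ofReal (c * ((1 / 2) ^ (2 - α) / (2 - α)) * R ^ α) ≤
      ∫⁻ s, ENNReal.ofReal (min ((|s| * R) ^ 2) 1) ∂tauMeasure β α p := by
  have hR0 : 0 < R := one_pos.trans hR
  have ha0 : 0 < 1 / 2 / R := by positivity
  have ha1 : 1 / 2 / R ≤ 1 / 2 := by rw [div_le_iff₀ hR0]; linarith
  refine le_trans ?_ ((hb _ (by fun_prop)).trans (setLIntegral_le_lintegral _ _))
  have hint : IntegrableOn (fun s : ℝ => s ^ (1 - α)) (Ioo 0 (1 / 2 / R)) :=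
    (intervalIntegral.integrableOn_Ioo_rpow_iff ha0).2 (by linarith)
  have hval : ∫ s in Ioo 0 (1 / 2 / R), R ^ 2 * s ^ (1 - α) =
      (1 / 2) ^ (2 - α) / (2 - α) * R ^ α := by
    rw [integral_const_mul, ← integral_Ioc_eq_integral_Ioo,
      ← intervalIntegral.integral_of_le ha0.le, integral_rpow (Or.inl (by linarith)),
      show 1 - α + 1 = 2 - α by ring, Real.zero_rpow (by linarith), sub_zero,
      Real.div_rpow (by norm_num) hR0.le, ← Real.rpow_two,
      show R ^ α = R ^ (2 : ℝ) / R ^ (2 - α) by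
        rw [← Real.rpow_sub hR0]; congr 1; ring]
    ring
  rw [mul_assoc, ENNReal.ofReal_mul hc.le, ← hval]
  refine mul_le_mul' le_rfl ?_
  rw [ofReal_integral_eq_lintegral_ofReal (hint.const_mul _)]
  · refine (setLIntegral_mono' measurableSet_Ioo fun s hs => ?_).trans
      (lintegral_mono_set (Ioo_subset_Ioo le_rfl ha1))
    have hs0 := hs.1
    rw [← ENNReal.ofReal_mul (by positivity), abs_of_pos hs0]
    refine ENNReal.ofReal_le_ofReal (le_of_eq ?_)
    have hsR : s * R < 1 / 2 := (lt_div_iff₀ hR0).1 hs.2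
    have hsR0 : 0 < s * R := by positivity
    rw [min_eq_left (by nlinarith), mul_pow, ← mul_assoc, ← Real.rpow_two s,
      ← Real.rpow_add hs0, mul_comm]
    congr 2
    ring
  · filter_upwards [ae_restrict_mem measurableSet_Ioo] with s hs
    have : 0 < s := hs.1
    positivity

theorem exists_lintegral_tauMeasure_indicator_le {α β p γ : ℝ} (hβα : β < α) (hp : 0 < p)
    (h : ∫⁻ s, ENNReal.ofReal (s ^ 2) ∂tauMeasure β α p < ⊤) (hγ0 : 0 ≤ γ) (hγα : γ < α)
    (F : Type*) [NormedAddCommGroup F] [NormedSpace ℝ F] :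
    ∃ D : ENNReal, D ≠ ⊤ ∧ ∀ x : F,
      ∫⁻ s, {y : F | 1 < ‖y‖}.indicator (fun y => ENNReal.ofReal (‖y‖ ^ γ)) (s • x)
          ∂tauMeasure β α p ≤
        D * ∫⁻ s, ENNReal.ofReal (min (‖s • x‖ ^ 2) 1) ∂tauMeasure β α p := by
  have hα2 := lt_two_of_lintegral_sq_tauMeasure_lt_top hβα hp h
  obtain ⟨c, C, hc, hC, hb⟩ := exists_tauMeasure_bounds hβα hp
  set k : ℝ := c * ((1 / 2) ^ (2 - α) / (2 - α))
  have hk : 0 < k := by have := sub_pos.2 hα2; positivity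
  refine ⟨(ENNReal.ofReal (C / (α - γ)) + tauMeasure β α p (Ico (1 / 2) 1)) *
    ENNReal.ofReal k⁻¹, ENNReal.mul_ne_top (ENNReal.add_ne_top.2
      ⟨ENNReal.ofReal_ne_top, (tauMeasure_Ico_lt_top h).ne⟩) ENNReal.ofReal_ne_top, fun x => ?_⟩
  rcases le_or_gt ‖x‖ 1 with hx | hx
  · refine le_of_eq_of_le ?_ zero_le
    rw [lintegral_congr_ae (g := fun _ => 0), lintegral_zero]
    filter_upwards [ae_tauMeasure_mem_Ioo β α p] with s hs
    refine indicator_of_notMem ?_ _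
    rw [mem_ofPred_eq, not_lt, norm_smul, Real.norm_eq_abs, abs_of_pos hs.1]
    exact mul_le_one₀ hs.2.le (norm_nonneg _) hx
  · have hx0 : 0 < ‖x‖ := one_pos.trans hx
    have hlow := le_lintegral_tauMeasure_min (β := β) (p := p) hα2 hx hc fun g hg => (hb g hg).1
    have hupp := lintegral_tauMeasure_tail_le (β := β) (p := p) hγ0 hγα hx hC
      fun g hg => (hb g hg).2
    simp_rw [norm_smul, Real.norm_eq_abs]
    have hRα : ENNReal.ofReal (‖x‖ ^ α) ≤ ENNReal.ofReal k⁻¹ *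
        ∫⁻ s, ENNReal.ofReal (min ((|s| * ‖x‖) ^ 2) 1) ∂tauMeasure β α p := by
      refine le_trans (le_of_eq ?_) (mul_le_mul' le_rfl hlow)
      rw [← ENNReal.ofReal_mul (by positivity), inv_mul_cancel_left₀ hk.ne']
    rw [mul_assoc]
    refine le_trans ?_ (hupp.trans (mul_le_mul' le_rfl hRα))
    refine lintegral_mono_ae ((ae_tauMeasure_mem_Ioo β α p).mono fun s hs => ?_)
    by_cases hsx : 1 < ‖s • x‖
    · rw [indicator_of_mem (show s • x ∈ {y : F | 1 < ‖y‖} from hsx), indicator_of_mem,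
        norm_smul, Real.norm_eq_abs]
      rw [norm_smul, Real.norm_eq_abs, abs_of_pos hs.1] at hsx
      exact (div_lt_iff₀ hx0).2 hsx
    · rw [indicator_of_notMem (show s • x ∉ {y : F | 1 < ‖y‖} from hsx)]
      exact zero_le

theorem exists_ne_zero_lintegral_lt_top {F : Type*} [NormedAddCommGroup F]
    [MeasurableSpace F] {M : Measure F} (hM0 : M {0} = 0) (hM : M ≠ 0)
    {G : F → ENNReal} (hG : Measurable G) (h : ∫⁻ x, G x ∂M < ⊤) : ∃ x, x ≠ 0 ∧ G x < ⊤ := by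
  have : NeZero M := ⟨hM⟩
  have hne : ∀ᵐ x ∂M, x ≠ 0 := by
    rw [ae_iff]
    simpa using hM0
  exact (hne.and (ae_lt_top hG h.ne)).exists

theorem setLIntegral_rpow_upsilon_tauMeasure_lt_top [SecondCountableTopology E] {α β p γ : ℝ}
    (hβα : β < α) (hp : 0 < p)
    (h : ∫⁻ s, ENNReal.ofReal (s ^ 2) ∂tauMeasure β α p < ⊤) (hγ0 : 0 ≤ γ) (hγα : γ < α)
    {M : Measure E} [SFinite M]
    (hM : ∫⁻ x, ∫⁻ s, ENNReal.ofReal (min (‖s • x‖ ^ 2) 1) ∂tauMeasure β α p ∂M < ⊤) :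
    ∫⁻ y in {y : E | 1 < ‖y‖}, ENNReal.ofReal (‖y‖ ^ γ) ∂Upsilon (tauMeasure β α p) M < ⊤ := by
  have hS : MeasurableSet {y : E | 1 < ‖y‖} := measurableSet_lt measurable_const measurable_norm
  have : SFinite (tauMeasure β α p) := by rw [tauMeasure_eq]; infer_instance
  obtain ⟨D, hD, hle⟩ := exists_lintegral_tauMeasure_indicator_le hβα hp h hγ0 hγα E
  rw [← lintegral_indicator hS, lintegral_upsilon _ _ (Measurable.indicator (by fun_prop) hS)]
  refine (lintegral_mono hle).trans_lt ?_
  rw [lintegral_const_mul' _ _ hD]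
  exact ENNReal.mul_lt_top hD.lt_top hM

theorem stmt7 (d : ℕ) (hd : 1 ≤ d) (β α q p : ℝ) (hβα : β < α) (hq : 0 < q) (hqp : q < p)
    (f : ℝ → ℝ) (hf : IsStableDensity (q / p) f) :
    UpsilonRange (E := EuclideanSpace ℝ (Fin d)) (tauMeasure β α p) ⊆
      UpsilonDomain (piMeasure f α p) := by
  have hp : 0 < p := hq.trans hqp
  rintro _ ⟨M, ⟨⟨hσ, hM0, hM⟩, hN⟩, rfl⟩
  refine ⟨hN, ?_⟩
  have : SFinite (tauMeasure β α p) := by rw [tauMeasure_eq]; infer_instance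
  have : SFinite (piMeasure f α p) := by rw [piMeasure_eq]; infer_instance
  have hπ0 : piMeasure f α p {0} = 0 := withDensity_absolutelyContinuous _ _ (by simp)
  by_cases hMz : M = 0
  · subst hMz
    have : Upsilon (piMeasure f α p)
        (Upsilon (tauMeasure β α p) (0 : Measure (EuclideanSpace ℝ (Fin d)))) = 0 := by
      simp [Upsilon]
    rw [this]
    exact ⟨inferInstance, by simp, by simp⟩
  have hdom := hN.2.2
  rw [lintegral_upsilon _ _ (by fun_prop)] at hdom
  have hmeas : Measurable fun x : EuclideanSpace ℝ (Fin d) =>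
      ∫⁻ s, ENNReal.ofReal (min (‖s • x‖ ^ 2) 1) ∂tauMeasure β α p :=
    Measurable.lintegral_prod_left' (f := fun z : ℝ × EuclideanSpace ℝ (Fin d) =>
      ENNReal.ofReal (min (‖z.1 • z.2‖ ^ 2) 1)) (by fun_prop)
  obtain ⟨x, hx, hxfin⟩ := exists_ne_zero_lintegral_lt_top hM0 hMz hmeas hdom
  have hsq := lintegral_sq_tauMeasure_lt_top hx hxfin
  have hα2 := lt_two_of_lintegral_sq_tauMeasure_lt_top hβα hp hsq
  have h2 := lintegral_piMeasure_rpow_lt_top hq hp hf (α := α) (γ := 2) (by linarith)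
  rcases lt_or_ge α q with hαq | hαq
  · refine isLevyMeasure_upsilon_of_moment hπ0 le_rfl zero_le_two h2
      (lintegral_piMeasure_rpow_lt_top hq hp hf (by linarith)) hN
      (lt_of_le_of_lt ?_ hN.2.2)
    refine (setLIntegral_mono' (measurableSet_lt measurable_const measurable_norm)
      fun y hy => ?_).trans (setLIntegral_le_lintegral _ _)
    rw [Real.rpow_zero, min_eq_right (one_le_pow₀ (le_of_lt hy))]
  · exact isLevyMeasure_upsilon_of_moment hπ0 (γ := α - q / 2) (by linarith) (by linarith) h2
      (lintegral_piMeasure_rpow_lt_top hq hp hf (by linarith)) hN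
      (setLIntegral_rpow_upsilon_tauMeasure_lt_top hβα hp hsq (by linarith) (by linarith) hdom)
end
end

section
/- Let d ≥ 1, 0 < r < q < p < ∞ and −∞ < α < 2 + r. Then 𝔓_{α,p→r} = 𝔓_{α,q→r} ∘ 𝔓_{α,p→q}: the domains coincide, i.e. 𝔇(𝔓_{α,p→r}) = {M ∈ 𝔇(𝔓_{α,p→q}) : 𝔓_{α,p→q}M ∈ 𝔇(𝔓_{α,q→r})}, and for every M in this common domain one has 𝔓_{α,q→r}(𝔓_{α,p→q} M) = 𝔓_{α,p→r} M as measures on ℝ^d. -/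
open MeasureTheory Set

noncomputable section

variable {E : Type*} [NormedAddCommGroup E] [NormedSpace ℝ E]
  [MeasurableSpace E] [BorelSpace E]

/-- Finite measures on the unit interval are determined by their moments. -/
lemma MeasureTheory.Measure.unitInterval_ext_of_moments {μ ν : Measure unitInterval}
    [IsFiniteMeasure μ] [IsFiniteMeasure ν]
    (h : ∀ n : ℕ, ∫ x, (x : ℝ) ^ n ∂μ = ∫ x, (x : ℝ) ^ n ∂ν) : μ = ν := by
  have hint (ρ : Measure unitInterval) [IsFiniteMeasure ρ] (f : C(unitInterval, ℝ)) :
      Integrable (fun x => f x) ρ :=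
    (BoundedContinuousFunction.mkOfCompact f).integrable ρ
  have hcont (ρ : Measure unitInterval) [IsFiniteMeasure ρ] :
      Continuous fun f : C(unitInterval, ℝ) => ∫ x, f x ∂ρ := by
    refine LipschitzWith.continuous (K := (ρ univ).toNNReal) (LipschitzWith.of_dist_le_mul ?_)
    intro f g
    rw [Real.dist_eq, ← integral_sub (hint ρ f) (hint ρ g)]
    have := norm_integral_le_of_norm_le_const (μ := ρ) (f := fun x => f x - g x)
      (C := dist f g) (Filter.Eventually.of_forall fun x => by
        simpa [Real.dist_eq] using ContinuousMap.dist_apply_le_dist (f := f) (g := g) x)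
    rw [Real.norm_eq_abs] at this
    rw [mul_comm]
    exact this
  have hclosed : IsClosed {f : C(unitInterval, ℝ) | ∫ x, f x ∂μ = ∫ x, f x ∂ν} :=
    isClosed_eq (hcont μ) (hcont ν)
  have hpoly : (polynomialFunctions unitInterval : Set C(unitInterval, ℝ)) ⊆
      {f | ∫ x, f x ∂μ = ∫ x, f x ∂ν} := by
    rintro f hf
    simp only [polynomialFunctions_coe] at hf
    obtain ⟨P, rfl⟩ := hf
    simp only [Set.mem_ofPred_eq, Polynomial.toContinuousMapOnAlgHom_apply,
      Polynomial.toContinuousMapOn_apply, Polynomial.toContinuousMap_apply,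
      Polynomial.eval_eq_sum_range]
    have hi (ρ : Measure unitInterval) [IsFiniteMeasure ρ] (n : ℕ) :
        Integrable (fun x : unitInterval => P.coeff n * (x : ℝ) ^ n) ρ :=
      hint ρ ⟨fun x => P.coeff n * (x : ℝ) ^ n, by fun_prop⟩
    rw [integral_finsetSum _ fun n _ => hi μ n, integral_finsetSum _ fun n _ => hi ν n]
    simp only [integral_const_mul, h]
  refine ext_of_forall_integral_eq_of_IsFiniteMeasure fun f => ?_
  have hf : f.toContinuousMap ∈ (polynomialFunctions unitInterval).topologicalClosure := by
    rw [polynomialFunctions_closure_eq_top']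
    exact Algebra.mem_top
  exact closure_minimal hpoly hclosed hf

/-- Finite measures on `[0, ∞)` are determined by their Laplace transforms at the naturals. -/
lemma MeasureTheory.Measure.ext_of_laplace {μ ν : Measure ℝ}
    [IsFiniteMeasure μ] [IsFiniteMeasure ν]
    (hμ : ∀ᵐ x ∂μ, 0 < x) (hν : ∀ᵐ x ∂ν, 0 < x)
    (h : ∀ n : ℕ, ∫⁻ x, ENNReal.ofReal (Real.exp (-(n * x))) ∂μ =
      ∫⁻ x, ENNReal.ofReal (Real.exp (-(n * x))) ∂ν) : μ = ν := by
  set φ : ℝ → unitInterval := fun x => projIcc 0 1 zero_le_one (Real.exp (-x)) with hφ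
  have hφm : Measurable φ := by
    have : Continuous φ := continuous_projIcc.comp (by fun_prop)
    exact this.measurable
  have hφv {x : ℝ} (hx : 0 < x) : ((φ x : unitInterval) : ℝ) = Real.exp (-x) := by
    simp only [hφ]
    rw [projIcc_of_mem zero_le_one ⟨(Real.exp_pos _).le, by simp [hx.le]⟩]
  have hmom (ρ : Measure ℝ) (hρ : ∀ᵐ x ∂ρ, 0 < x) (n : ℕ) :
      ∫ y, (y : ℝ) ^ n ∂(ρ.map φ) =
        (∫⁻ x, ENNReal.ofReal (Real.exp (-(n * x))) ∂ρ).toReal := by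
    rw [integral_map hφm.aemeasurable (by fun_prop),
      ← integral_eq_lintegral_of_nonneg_ae
        (Filter.Eventually.of_forall fun x => (Real.exp_pos _).le) (by fun_prop)]
    refine integral_congr_ae ?_
    filter_upwards [hρ] with x hx
    rw [hφv hx, ← Real.exp_nat_mul]
    ring_nf
  have hmap : μ.map φ = ν.map φ :=
    Measure.unitInterval_ext_of_moments fun n => by rw [hmom μ hμ, hmom ν hν, h]
  have hback (ρ : Measure ℝ) (hρ : ∀ᵐ x ∂ρ, 0 < x) :
      (ρ.map φ).map (fun y : unitInterval => -Real.log y) = ρ := by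
    rw [Measure.map_map (by fun_prop) hφm]
    conv_rhs => rw [← Measure.map_id (μ := ρ)]
    refine Measure.map_congr ?_
    filter_upwards [hρ] with x hx
    simp [hφv hx]
  rw [← hback μ hμ, hmap, hback ν hν]

/-- The law on `(0, ∞)` with density `f`. -/
def stableLaw (f : ℝ → ℝ) : Measure ℝ :=
  (volume.restrict (Ioi 0)).withDensity fun x => ENNReal.ofReal (f x)

instance (f : ℝ → ℝ) : SigmaFinite (stableLaw f) :=
  inferInstanceAs (SigmaFinite ((volume.restrict (Ioi (0 : ℝ))).withDensity
    fun x => ENNReal.ofReal (f x)))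

instance (f : ℝ → ℝ) (α p : ℝ) : SFinite (piMeasure f α p) :=
  inferInstanceAs (SFinite ((volume : Measure ℝ).withDensity _))

lemma ae_stableLaw_pos (f : ℝ → ℝ) : ∀ᵐ x ∂stableLaw f, 0 < x :=
  (withDensity_absolutelyContinuous _ _).ae_le (ae_restrict_mem measurableSet_Ioi)

namespace IsStableDensity

variable {r : ℝ} {f : ℝ → ℝ}

lemma lintegral_exp (hf : IsStableDensity r f) {t : ℝ} (ht : 0 ≤ t) :
    ∫⁻ x, ENNReal.ofReal (Real.exp (-(t * x))) ∂stableLaw f =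
      ENNReal.ofReal (Real.exp (-(t ^ r))) := by
  obtain ⟨hm, h0, hL⟩ := hf
  have hint : Integrable (fun x => Real.exp (-(t * x)) * f x) (volume.restrict (Ioi 0)) := by
    by_contra hni
    have := hL t ht
    rw [integral_undef hni] at this
    exact (Real.exp_pos _).ne this
  rw [← hL t ht, ofReal_integral_eq_lintegral_ofReal hint
    (Filter.Eventually.of_forall fun x => mul_nonneg (Real.exp_pos _).le (h0 x)), stableLaw,
    lintegral_withDensity_eq_lintegral_mul _ (by fun_prop) (by fun_prop)]
  refine lintegral_congr fun x => ?_
  rw [Pi.mul_apply, mul_comm, ENNReal.ofReal_mul (Real.exp_pos _).le]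

lemma stableLaw_univ_ne_zero (hf : IsStableDensity r f) : stableLaw f univ ≠ 0 := by
  have := hf.lintegral_exp le_rfl
  simp only [zero_mul, neg_zero, Real.exp_zero, ENNReal.ofReal_one, lintegral_one] at this
  rw [this]
  exact (ENNReal.ofReal_pos.2 (Real.exp_pos _)).ne'

lemma isFiniteMeasure_stableLaw (hf : IsStableDensity r f) : IsFiniteMeasure (stableLaw f) := by
  have := hf.lintegral_exp le_rfl
  simp only [zero_mul, neg_zero, Real.exp_zero, ENNReal.ofReal_one, lintegral_one] at this
  exact ⟨this ▸ ENNReal.ofReal_lt_top⟩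

/-- Subordination: if `X`, `Y` are independent with one-sided `a`- and `b`-stable laws, then
`X * Y ^ a⁻¹` has the one-sided `a * b`-stable law. -/
lemma map_mul_rpow {a b : ℝ} {g h : ℝ → ℝ} (ha : 0 < a)
    (hf : IsStableDensity a f) (hg : IsStableDensity b g) (hh : IsStableDensity (a * b) h) :
    ((stableLaw f).prod (stableLaw g)).map (fun z => z.1 * z.2 ^ a⁻¹) = stableLaw h := by
  have := hf.isFiniteMeasure_stableLaw
  have := hg.isFiniteMeasure_stableLaw
  have := hh.isFiniteMeasure_stableLaw
  have hm : Measurable fun z : ℝ × ℝ => z.1 * z.2 ^ a⁻¹ := by fun_prop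
  refine Measure.ext_of_laplace ?_ (ae_stableLaw_pos h) fun n => ?_
  · rw [ae_map_iff hm.aemeasurable measurableSet_Ioi]
    filter_upwards [Measure.quasiMeasurePreserving_fst.ae (ae_stableLaw_pos f),
      Measure.quasiMeasurePreserving_snd.ae (ae_stableLaw_pos g)] with z h1 h2
    exact mul_pos h1 (Real.rpow_pos_of_pos h2 _)
  · rw [lintegral_map (by fun_prop) hm, lintegral_prod_symm _ (by fun_prop),
      hh.lintegral_exp n.cast_nonneg]
    have key : ∀ᵐ y ∂stableLaw g,
        ∫⁻ x, ENNReal.ofReal (Real.exp (-(n * (x * y ^ a⁻¹)))) ∂stableLaw f =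
          ENNReal.ofReal (Real.exp (-((n : ℝ) ^ a * y))) := by
      filter_upwards [ae_stableLaw_pos g] with y hy
      have hy' : 0 ≤ (n : ℝ) * y ^ a⁻¹ := by positivity
      have := hf.lintegral_exp hy'
      rw [Real.mul_rpow n.cast_nonneg (by positivity), Real.rpow_inv_rpow hy.le ha.ne'] at this
      rw [← this]
      refine lintegral_congr fun x => ?_
      ring_nf
    rw [lintegral_congr_ae key, hg.lintegral_exp (by positivity), ← Real.rpow_mul n.cast_nonneg]

end IsStableDensity

lemma lintegral_piMeasure {f : ℝ → ℝ} (hf : Measurable f) (α : ℝ) {p : ℝ} (hp : 0 < p)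
    {g : ℝ → ENNReal} (hg : Measurable g) :
    ∫⁻ s, g s ∂piMeasure f α p =
      ∫⁻ u, g (u ^ (-p⁻¹)) * ENNReal.ofReal (u ^ (α / p)) ∂stableLaw f := by
  have hpi : ∫⁻ s, g s ∂piMeasure f α p =
      ∫⁻ s in Ioi 0, ENNReal.ofReal (p * f (s ^ (-p)) * s ^ (-α - p - 1)) * g s := by
    rw [piMeasure, lintegral_withDensity_eq_lintegral_mul _
      (Measurable.ite measurableSet_Ioi (by fun_prop) (by fun_prop)) hg,
      ← lintegral_indicator measurableSet_Ioi]
    refine lintegral_congr fun s => ?_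
    by_cases hs : 0 < s <;> simp [hs, indicator]
  have himg : (fun s : ℝ => s ^ (-p)) '' Ioi 0 = Ioi 0 := by
    ext u
    constructor
    · rintro ⟨s, hs, rfl⟩
      exact Real.rpow_pos_of_pos hs _
    · intro hu
      refine ⟨u ^ (-p)⁻¹, Real.rpow_pos_of_pos hu _, ?_⟩
      exact Real.rpow_inv_rpow (le_of_lt hu) (by linarith)
  have hinj : InjOn (fun s : ℝ => s ^ (-p)) (Ioi 0) := by
    intro s hs t ht hst
    have := congrArg (fun u : ℝ => u ^ (-p)⁻¹) hst
    simpa only [Real.rpow_rpow_inv (le_of_lt hs) (neg_ne_zero.2 hp.ne'),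
      Real.rpow_rpow_inv (le_of_lt ht) (neg_ne_zero.2 hp.ne')] using this
  have hderiv : ∀ s ∈ Ioi (0 : ℝ),
      HasDerivWithinAt (fun s : ℝ => s ^ (-p)) (-p * s ^ (-p - 1)) (Ioi 0) s := fun s hs =>
    (Real.hasDerivAt_rpow_const (Or.inl (ne_of_gt hs))).hasDerivWithinAt
  rw [hpi, stableLaw, lintegral_withDensity_eq_lintegral_mul _ (by fun_prop) (by fun_prop)]
  conv_rhs => rw [← himg]
  rw [lintegral_image_eq_lintegral_abs_deriv_mul measurableSet_Ioi hderiv hinj]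
  refine setLIntegral_congr_fun measurableSet_Ioi fun s hs => ?_
  have hs : 0 < s := hs
  have hsp : (s ^ (-p)) ^ (-p⁻¹) = s := by
    rw [← Real.rpow_mul hs.le]
    field_simp
    simp
  have habs : |-p * s ^ (-p - 1)| = p * s ^ (-p - 1) := by
    rw [abs_mul, abs_neg, abs_of_pos hp, abs_of_pos (Real.rpow_pos_of_pos hs _)]
  have hα : (s ^ (-p)) ^ (α / p) = s ^ (-α) := by
    rw [← Real.rpow_mul hs.le]
    congr 1
    field_simp
  have hpow : s ^ (-α - p - 1) = s ^ (-p - 1) * s ^ (-α) := by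
    rw [← Real.rpow_add hs]
    ring_nf
  have h1 : 0 ≤ p * s ^ (-p - 1) := by positivity
  have h2 : 0 ≤ s ^ (-α) := by positivity
  simp only [Pi.mul_apply]
  rw [hsp, habs, hα, hpow, show p * f (s ^ (-p)) * (s ^ (-p - 1) * s ^ (-α)) =
    (p * s ^ (-p - 1)) * (s ^ (-α) * f (s ^ (-p))) by ring, ENNReal.ofReal_mul h1,
    ENNReal.ofReal_mul h2]
  ring

lemma ae_piMeasure_pos {f : ℝ → ℝ} (hf : Measurable f) (α p : ℝ) :
    ∀ᵐ s ∂piMeasure f α p, 0 < s := by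
  rw [piMeasure, ae_withDensity_iff
    (Measurable.ite measurableSet_Ioi (by fun_prop) (by fun_prop))]
  refine Filter.Eventually.of_forall fun s hs => ?_
  by_contra h
  simp [h] at hs

lemma IsStableDensity.piMeasure_ne_zero {r : ℝ} {f : ℝ → ℝ} (hf : IsStableDensity r f)
    (α : ℝ) {p : ℝ} (hp : 0 < p) : piMeasure f α p ≠ 0 := by
  intro h
  have h0 := lintegral_piMeasure hf.1 α hp (g := fun _ => 1) measurable_const
  rw [h, lintegral_zero_measure, eq_comm, lintegral_eq_zero_iff (by fun_prop)] at h0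
  have : ∀ᵐ u ∂stableLaw f, False := by
    filter_upwards [h0, ae_stableLaw_pos f] with u hu hpos
    have := Real.rpow_pos_of_pos hpos (α / p)
    simp only [one_mul, Pi.zero_apply, ENNReal.ofReal_eq_zero] at hu
    linarith
  rw [ae_iff] at this
  exact hf.stableLaw_univ_ne_zero (by simpa using this)

/-- The dilation measures `π` compose under multiplicative convolution. -/
lemma lintegral_lintegral_piMeasure {α p q r : ℝ} (hp : 0 < p) (hq : 0 < q)
    {fpq fqr fpr : ℝ → ℝ} (hpq : IsStableDensity (q / p) fpq) (hqr : IsStableDensity (r / q) fqr)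
    (hpr : IsStableDensity (r / p) fpr) {g : ℝ → ENNReal} (hg : Measurable g) :
    ∫⁻ s, ∫⁻ t, g (s * t) ∂piMeasure fpq α p ∂piMeasure fqr α q =
      ∫⁻ s, g s ∂piMeasure fpr α p := by
  have hmul : q / p * (r / q) = r / p := by field_simp
  have hlaw := hpq.map_mul_rpow (div_pos hq hp) hqr (hmul ▸ hpr)
  rw [lintegral_piMeasure hpr.1 α hp hg, ← hlaw, lintegral_map (by fun_prop) (by fun_prop),
    lintegral_prod_symm _ (by fun_prop),
    lintegral_piMeasure hqr.1 α hq (Measurable.lintegral_prod_right (by fun_prop))]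
  refine lintegral_congr_ae ?_
  filter_upwards [ae_stableLaw_pos fqr] with y hy
  rw [lintegral_piMeasure hpq.1 α hp (by fun_prop), ← lintegral_mul_const _ (by fun_prop)]
  refine lintegral_congr_ae ?_
  filter_upwards [ae_stableLaw_pos fpq] with x hx
  have e1 : (x * y ^ (q / p)⁻¹) ^ (-p⁻¹) = y ^ (-q⁻¹) * x ^ (-p⁻¹) := by
    rw [Real.mul_rpow hx.le (by positivity), ← Real.rpow_mul hy.le, mul_comm]
    congr 2
    field_simp
  have e2 : (x * y ^ (q / p)⁻¹) ^ (α / p) = x ^ (α / p) * y ^ (α / q) := by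
    rw [Real.mul_rpow hx.le (by positivity), ← Real.rpow_mul hy.le]
    congr 2
    field_simp
  rw [e1, e2, ENNReal.ofReal_mul (by positivity), mul_assoc]

/-- The integrability condition, with no mass at the origin, forces σ-finiteness. -/
lemma IsLevyMeasure.of_lintegral_lt_top {F : Type*} [NormedAddCommGroup F] [MeasurableSpace F]
    [BorelSpace F] {M : Measure F} (h0 : M {0} = 0)
    (hM : ∫⁻ x, ENNReal.ofReal (min (‖x‖ ^ 2) 1) ∂M < ⊤) : IsLevyMeasure M := by
  refine ⟨?_, h0, hM⟩
  set g : F → ENNReal := fun x => ENNReal.ofReal (min (‖x‖ ^ 2) 1) with hg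
  have hgm : Measurable g := by fun_prop
  have hg0 : ∀ᵐ x ∂M, g x ≠ 0 := by
    have : ∀ᵐ x ∂M, x ≠ 0 := by simpa [ae_iff] using h0
    filter_upwards [this] with x hx
    have : 0 < ‖x‖ := norm_pos_iff.2 hx
    exact (ENNReal.ofReal_pos.2 (lt_min (by positivity) one_pos)).ne'
  have : IsFiniteMeasure (M.withDensity g) := isFiniteMeasure_withDensity hM.ne
  rw [← withDensity_inv_same hgm hg0 (Filter.Eventually.of_forall fun x => ENNReal.ofReal_ne_top)]
  refine SigmaFinite.withDensity_of_ne_top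
    ((withDensity_absolutelyContinuous M g).ae_le ?_)
  filter_upwards [hg0] with x hx
  simpa using hx

section Upsilon

variable [SecondCountableTopology E]

instance (ρ : Measure ℝ) [SFinite ρ] (M : Measure E) [SFinite M] : SFinite (Upsilon ρ M) :=
  inferInstanceAs (SFinite (Measure.map _ _))

lemma lintegral_Upsilon (ρ : Measure ℝ) (M : Measure E) [SFinite M]
    {g : E → ENNReal} (hg : Measurable g) :
    ∫⁻ x, g x ∂Upsilon ρ M = ∫⁻ s, ∫⁻ x, g (s • x) ∂M ∂ρ := by
  rw [Upsilon, lintegral_map hg (by fun_prop), lintegral_prod _ (by fun_prop)]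

lemma Upsilon_piMeasure_comp {α p q r : ℝ} (hp : 0 < p) (hq : 0 < q)
    {fpq fqr fpr : ℝ → ℝ} (hpq : IsStableDensity (q / p) fpq) (hqr : IsStableDensity (r / q) fqr)
    (hpr : IsStableDensity (r / p) fpr) (M : Measure E) [SFinite M] :
    Upsilon (piMeasure fqr α q) (Upsilon (piMeasure fpq α p) M) =
      Upsilon (piMeasure fpr α p) M := by
  refine Measure.ext_of_lintegral _ fun g hg => ?_
  have hG : Measurable fun s : ℝ => ∫⁻ x, g (s • x) ∂M :=
    Measurable.lintegral_prod_right (f := fun (s : ℝ) (x : E) => g (s • x)) (by fun_prop)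
  rw [lintegral_Upsilon _ _ hg, lintegral_Upsilon _ _ hg,
    ← lintegral_lintegral_piMeasure hp hq hpq hqr hpr hG]
  refine lintegral_congr fun s => ?_
  rw [lintegral_Upsilon _ _ (by fun_prop)]
  simp only [mul_smul]

lemma Upsilon_singleton_zero {ρ : Measure ℝ} (hρ : ∀ᵐ s ∂ρ, 0 < s) {M : Measure E} [SFinite M]
    (hM : M {0} = 0) : Upsilon ρ M {0} = 0 := by
  rw [← lintegral_indicator_one (measurableSet_singleton 0),
    lintegral_Upsilon _ _ (measurable_one.indicator (measurableSet_singleton 0))]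
  refine (lintegral_congr_ae (g := fun _ => 0) ?_).trans lintegral_zero
  filter_upwards [hρ] with s hs
  rw [← hM, ← lintegral_indicator_one (measurableSet_singleton 0)]
  refine lintegral_congr fun x => ?_
  have hiff : s • x ∈ ({0} : Set E) ↔ x ∈ ({0} : Set E) := by
    rw [mem_singleton_iff, mem_singleton_iff, smul_eq_zero_iff_right hs.ne']
  by_cases hx : x ∈ ({0} : Set E)
  · rw [indicator_of_mem hx, indicator_of_mem (hiff.2 hx)]
    rfl
  · rw [indicator_of_notMem hx, indicator_of_notMem (mt hiff.1 hx)]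

lemma IsLevyMeasure.of_Upsilon {ρ : Measure ℝ} (hρ : ∀ᵐ s ∂ρ, 0 < s) (hρ0 : ρ ≠ 0)
    {M : Measure E} [SFinite M] (h0 : M {0} = 0) (hU : IsLevyMeasure (Upsilon ρ M)) :
    IsLevyMeasure M := by
  refine .of_lintegral_lt_top h0 ?_
  have hfin := hU.2.2
  rw [lintegral_Upsilon _ _ (by fun_prop)] at hfin
  have hae := ae_lt_top (Measurable.lintegral_prod_right (ν := M)
    (f := fun (s : ℝ) (x : E) => ENNReal.ofReal (min (‖s • x‖ ^ 2) 1)) (by fun_prop)) hfin.ne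
  have : (ae ρ).NeBot := ae_neBot.2 hρ0
  obtain ⟨s, hs, hspos⟩ := (hae.and hρ).exists
  have hc : 0 < min (s ^ 2) 1 := lt_min (by positivity) one_pos
  refine lt_of_le_of_lt ?_
    (ENNReal.mul_lt_top (ENNReal.ofReal_lt_top (r := (min (s ^ 2) 1)⁻¹)) hs)
  rw [← lintegral_const_mul _ (by fun_prop)]
  refine lintegral_mono fun x => ?_
  rw [← ENNReal.ofReal_mul (inv_nonneg.2 hc.le)]
  refine ENNReal.ofReal_le_ofReal ?_
  rw [le_inv_mul_iff₀ hc, norm_smul, mul_pow, Real.norm_eq_abs, sq_abs]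
  have hx : 0 ≤ min (‖x‖ ^ 2) 1 := by positivity
  refine le_min ?_ ?_
  · exact mul_le_mul (min_le_left _ _) (min_le_left _ _) hx (by positivity)
  · exact mul_le_one₀ (min_le_right _ _) hx (min_le_right _ _)

end Upsilon

theorem stmt11 (d : ℕ) (hd : 1 ≤ d) (α r q p : ℝ) (hr : 0 < r) (hrq : r < q) (hqp : q < p)
    (hα : α < 2 + r)
    (fpr : ℝ → ℝ) (hfpr : IsStableDensity (r / p) fpr)
    (fqr : ℝ → ℝ) (hfqr : IsStableDensity (r / q) fqr)
    (fpq : ℝ → ℝ) (hfpq : IsStableDensity (q / p) fpq) :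
    UpsilonDomain (E := EuclideanSpace ℝ (Fin d)) (piMeasure fpr α p) =
      {M ∈ UpsilonDomain (piMeasure fpq α p) |
        Upsilon (piMeasure fpq α p) M ∈ UpsilonDomain (piMeasure fqr α q)} ∧
    ∀ M ∈ UpsilonDomain (E := EuclideanSpace ℝ (Fin d)) (piMeasure fpr α p),
      Upsilon (piMeasure fqr α q) (Upsilon (piMeasure fpq α p) M) =
        Upsilon (piMeasure fpr α p) M := by
  have hq : 0 < q := hr.trans hrq
  have hp : 0 < p := hq.trans hqp
  have hcomp (M : Measure (EuclideanSpace ℝ (Fin d))) [SFinite M] :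
      Upsilon (piMeasure fqr α q) (Upsilon (piMeasure fpq α p) M) =
        Upsilon (piMeasure fpr α p) M :=
    Upsilon_piMeasure_comp hp hq hfpq hfqr hfpr M
  refine ⟨?_, fun M hM => ?_⟩
  · ext M
    constructor
    · rintro ⟨hM, hU⟩
      have := hM.1
      rw [← hcomp M] at hU
      have hN : IsLevyMeasure (Upsilon (piMeasure fpq α p) M) :=
        .of_Upsilon (ae_piMeasure_pos hfqr.1 α q) (hfqr.piMeasure_ne_zero α hq)
          (Upsilon_singleton_zero (ae_piMeasure_pos hfpq.1 α p) hM.2.1) hU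
      exact ⟨⟨hM, hN⟩, hN, hU⟩
    · rintro ⟨⟨hM, -⟩, -, hU⟩
      have := hM.1
      rw [hcomp M] at hU
      exact ⟨hM, hU⟩
  · have := hM.1.1
    exact hcomp M
end
end

section
/- Let d ≥ 1, 0 < q < p < ∞ and α < 0. Then the transform 𝔓_{α,p→q} is one-to-one on its domain: if M, M′ ∈ 𝔇(𝔓_{α,p→q}) and 𝔓_{α,p→q} M = 𝔓_{α,p→q} M′, then M = M′. -/
open MeasureTheory Set

noncomputable section

variable {E : Type*} [NormedAddCommGroup E] [NormedSpace ℝ E]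
  [MeasurableSpace E] [BorelSpace E]

/-- The function `x ↦ ‖x‖^α e^{-k ‖x‖^{-q}}`. -/
def dampedPower (α q k : ℝ) (x : E) : ℝ := ‖x‖ ^ α * Real.exp (-(k * ‖x‖ ^ (-q)))

/-- The direction `x / ‖x‖` of a vector. -/
def direction (x : E) : E := ‖x‖⁻¹ • x

/-- A finite measure on `ℝ` with exponential moments of all orders below some `a > 0` is determined
by its two-sided Laplace transform. -/
theorem measure_eq_of_lintegral_exp_eq {μ ν : Measure ℝ} {a : ℝ} (ha : 0 < a)
    (hμ : ∀ t < a, ∫⁻ y, ENNReal.ofReal (Real.exp (t * y)) ∂μ < ⊤)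
    (h : ∀ t < a, ∫⁻ y, ENNReal.ofReal (Real.exp (t * y)) ∂μ =
      ∫⁻ y, ENNReal.ofReal (Real.exp (t * y)) ∂ν) : μ = ν := by
  have fin_of {ρ : Measure ℝ}
      (hρ : ∀ t < a, ∫⁻ y, ENNReal.ofReal (Real.exp (t * y)) ∂ρ < ⊤) : IsFiniteMeasure ρ :=
    ⟨by simpa using hρ 0 ha⟩
  have hν : ∀ t < a, ∫⁻ y, ENNReal.ofReal (Real.exp (t * y)) ∂ν < ⊤ := fun t ht =>
    h t ht ▸ hμ t ht
  have := fin_of hμ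
  have := fin_of hν
  have strip {ρ : Measure ℝ} (hρ : ∀ t < a, ∫⁻ y, ENNReal.ofReal (Real.exp (t * y)) ∂ρ < ⊤) :
      Iio a ⊆ interior (ProbabilityTheory.integrableExpSet id ρ) := by
    refine interior_maximal (fun t ht => ?_) isOpen_Iio
    refine ⟨by fun_prop, ?_⟩
    rw [hasFiniteIntegral_iff_ofReal (Filter.Eventually.of_forall fun _ => (Real.exp_pos _).le)]
    exact hρ t ht
  have analytic {ρ : Measure ℝ}
      (hρ : ∀ t < a, ∫⁻ y, ENNReal.ofReal (Real.exp (t * y)) ∂ρ < ⊤) :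
      AnalyticOnNhd ℂ (ProbabilityTheory.complexMGF id ρ) {z | z.re < a} :=
    ProbabilityTheory.analyticOnNhd_complexMGF.mono fun _ hz => strip hρ hz
  have mgf_eq : ∀ t < a, ProbabilityTheory.mgf id μ t = ProbabilityTheory.mgf id ν t := by
    intro t ht
    have toReal (ρ : Measure ℝ) : ProbabilityTheory.mgf id ρ t =
        (∫⁻ y, ENNReal.ofReal (Real.exp (t * y)) ∂ρ).toReal :=
      integral_eq_lintegral_of_nonneg_ae
        (Filter.Eventually.of_forall fun _ => (Real.exp_pos _).le) (by fun_prop)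
    rw [toReal, toReal, h t ht]
  have eqOn : EqOn (ProbabilityTheory.complexMGF id μ) (ProbabilityTheory.complexMGF id ν)
      {z | z.re < a} := by
    refine (analytic hμ).eqOn_of_preconnected_of_frequently_eq (analytic hν)
      (convex_halfSpace_re_lt a).isPreconnected (z₀ := 0) (by simpa using ha) ?_
    have tendsto : Filter.Tendsto (fun n : ℕ => ((-(1 / ((n : ℝ) + 1)) : ℝ) : ℂ)) Filter.atTop
        (nhdsWithin 0 {0}ᶜ) := by
      rw [tendsto_nhdsWithin_iff]
      constructor
      · have := (tendsto_one_div_add_atTop_nhds_zero_nat (𝕜 := ℝ)).neg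
        rw [neg_zero] at this
        exact_mod_cast (Complex.continuous_ofReal.tendsto 0).comp this
      · refine Filter.Eventually.of_forall fun n => ?_
        simp only [mem_compl_iff, mem_singleton_iff, Complex.ofReal_eq_zero]
        have : (0 : ℝ) < 1 / ((n : ℝ) + 1) := by positivity
        linarith
    refine tendsto.frequently (Filter.Frequently.of_forall fun n => ?_)
    rw [ProbabilityTheory.complexMGF_ofReal, ProbabilityTheory.complexMGF_ofReal, mgf_eq]
    have : (0 : ℝ) < 1 / ((n : ℝ) + 1) := by positivity
    linarith
  refine Measure.ext_of_charFun (funext fun t => ?_)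
  have := eqOn (x := (t : ℂ) * Complex.I) (by simpa using ha)
  rwa [ProbabilityTheory.complexMGF_id_mul_I, ProbabilityTheory.complexMGF_id_mul_I] at this

/-- The Laplace transform of `π_{α,p→q}` after the substitution `u = s^{-p}`. -/
theorem lintegral_piMeasure_damped {f : ℝ → ℝ} {α q p : ℝ} (hp : 0 < p)
    (hf : IsStableDensity (q / p) f) {t : ℝ} (ht : 0 ≤ t) :
    ∫⁻ s, ENNReal.ofReal (s ^ α * Real.exp (-(t * s ^ (-p)))) ∂(piMeasure f α p) =
      ENNReal.ofReal (Real.exp (-(t ^ (q / p)))) := by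
  obtain ⟨hfm, hf0, hfL⟩ := hf
  set g : ℝ → ℝ := fun x => Real.exp (-(t * x)) * f x with hg
  have hgi : IntegrableOn g (Ioi 0) := by
    by_contra hni
    have := (integral_undef hni).symm.trans (hfL t ht)
    exact (Real.exp_pos _).ne this
  have hci := (integrableOn_Ioi_comp_rpow_iff g (neg_ne_zero.2 hp.ne')).2 hgi
  have hce := (integral_comp_rpow_Ioi g (neg_ne_zero.2 hp.ne')).trans (hfL t ht)
  have hnn : 0 ≤ᵐ[volume.restrict (Ioi 0)]
      fun x : ℝ => (|(-p)| * x ^ (-p - 1)) • g (x ^ (-p)) := by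
    filter_upwards [ae_restrict_mem measurableSet_Ioi] with x hx
    have hx0 : (0 : ℝ) < x := hx
    have := hf0 (x ^ (-p))
    simp only [hg, smul_eq_mul, Pi.zero_apply]
    positivity
  rw [← hce, ofReal_integral_eq_lintegral_ofReal hci hnn, piMeasure,
    lintegral_withDensity_eq_lintegral_mul _
      (Measurable.ite measurableSet_Ioi (by fun_prop) measurable_const) (by fun_prop),
    ← lintegral_indicator measurableSet_Ioi]
  refine lintegral_congr fun s => ?_
  by_cases hs : 0 < s
  · have := hf0 (s ^ (-p))
    rw [indicator_of_mem (show s ∈ Ioi 0 from hs), Pi.mul_apply, if_pos hs,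
      ← ENNReal.ofReal_mul (by positivity)]
    congr 1
    have hpow : s ^ (-α - p - 1) * s ^ α = s ^ (-p - 1) := by
      rw [← Real.rpow_add hs]; ring_nf
    simp only [hg, smul_eq_mul, abs_neg, abs_of_pos hp, ← hpow]
    ring
  · rw [indicator_of_notMem (show s ∉ Ioi 0 from hs), Pi.mul_apply, if_neg hs, zero_mul]

theorem measurable_dampedPower
    {F : Type*} [NormedAddCommGroup F] [MeasurableSpace F] [BorelSpace F]
    (α q k : ℝ) : Measurable (dampedPower (E := F) α q k) := by
  unfold dampedPower
  fun_prop

theorem measurable_direction [SecondCountableTopology E] : Measurable (direction (E := E)) := by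
  unfold direction
  fun_prop

theorem direction_smul
    {F : Type*} [NormedAddCommGroup F] [NormedSpace ℝ F]
    {s : ℝ} (hs : 0 < s) (x : F) : direction (s • x) = direction x := by
  rw [direction, direction, norm_smul, Real.norm_of_nonneg hs.le, mul_inv, smul_smul]
  congr 1
  field_simp

theorem dampedPower_smul
    {F : Type*} [NormedAddCommGroup F] [NormedSpace ℝ F]
    {α p k s : ℝ} (hs : 0 < s) (x : F) :
    dampedPower α p k (s • x) = ‖x‖ ^ α * (s ^ α * Real.exp (-(k * ‖x‖ ^ (-p) * s ^ (-p)))) := by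
  rw [dampedPower, norm_smul, Real.norm_of_nonneg hs.le, Real.mul_rpow hs.le (norm_nonneg x),
    Real.mul_rpow hs.le (norm_nonneg x)]
  ring_nf

/-- Integrating a damped power of exponent `p` over a cone against the image of `M` under
`𝔓_{α,p→q}` amounts to integrating a damped power of exponent `q` against `M`. -/
theorem setLIntegral_upsilon_dampedPower [SecondCountableTopology E] {f : ℝ → ℝ} {α q p : ℝ}
    (hp : 0 < p) (hf : IsStableDensity (q / p) f) (M : Measure E) [SigmaFinite M]
    {k : ℝ} (hk : 0 ≤ k) {A : Set E} (hA : MeasurableSet A) :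
    ∫⁻ x in direction ⁻¹' A, ENNReal.ofReal (dampedPower α p k x) ∂(Upsilon (piMeasure f α p) M) =
      ∫⁻ x in direction ⁻¹' A, ENNReal.ofReal (dampedPower α q (k ^ (q / p)) x) ∂M := by
  have hA' : MeasurableSet (direction (E := E) ⁻¹' A) := measurable_direction hA
  have hF : Measurable ((direction (E := E) ⁻¹' A).indicator
      fun x => ENNReal.ofReal (dampedPower α p k x)) :=
    (measurable_dampedPower α p k).ennreal_ofReal.indicator hA'
  have hsmul : Measurable fun z : ℝ × E => z.1 • z.2 := by fun_prop
  have : SFinite (piMeasure f α p) := by unfold piMeasure; infer_instance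
  have hpos : ∀ᵐ s ∂(piMeasure f α p), 0 < s := by
    obtain ⟨hfm, -, -⟩ := hf
    rw [piMeasure, ae_withDensity_iff
      (Measurable.ite measurableSet_Ioi (by fun_prop) measurable_const)]
    exact Filter.Eventually.of_forall fun s hs => by
      by_contra hs0
      exact hs (if_neg hs0)
  rw [← lintegral_indicator hA', ← lintegral_indicator hA', Upsilon, lintegral_map hF hsmul]
  refine (lintegral_prod_symm' _ (hF.comp hsmul)).trans (lintegral_congr fun x => ?_)
  simp only [Function.comp_apply]
  by_cases hx : direction x ∈ A
  · rw [indicator_of_mem (show x ∈ direction ⁻¹' A from hx)]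
    have hcongr : ∀ᵐ s ∂(piMeasure f α p),
        (direction (E := E) ⁻¹' A).indicator (fun x => ENNReal.ofReal (dampedPower α p k x))
          (s • x) = ENNReal.ofReal (‖x‖ ^ α) *
            ENNReal.ofReal (s ^ α * Real.exp (-(k * ‖x‖ ^ (-p) * s ^ (-p)))) := by
      filter_upwards [hpos] with s hs
      rw [indicator_of_mem (show s • x ∈ direction ⁻¹' A by rwa [mem_preimage, direction_smul hs]),
        dampedPower_smul hs, ENNReal.ofReal_mul (by positivity)]
    rw [lintegral_congr_ae hcongr, lintegral_const_mul _ (by fun_prop),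
      lintegral_piMeasure_damped hp hf (by positivity), ← ENNReal.ofReal_mul (by positivity),
      dampedPower, Real.mul_rpow hk (by positivity), ← Real.rpow_mul (norm_nonneg x)]
    congr 5
    field_simp
  · rw [indicator_of_notMem (show x ∉ direction ⁻¹' A from hx), ← lintegral_zero]
    refine lintegral_congr_ae ?_
    filter_upwards [hpos] with s hs
    exact indicator_of_notMem (by rwa [mem_preimage, direction_smul hs]) _

theorem dampedPower_nonneg {F : Type*} [NormedAddCommGroup F]
    (α q k : ℝ) (x : F) : 0 ≤ dampedPower α q k x := by
  unfold dampedPower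
  positivity

theorem dampedPower_pos {F : Type*} [NormedAddCommGroup F] {α q k : ℝ} {x : F} (hx : x ≠ 0) : 0 < dampedPower α q k x :=
  mul_pos (Real.rpow_pos_of_pos (norm_pos_iff.2 hx) _) (Real.exp_pos _)

theorem exists_dampedPower_le {F : Type*} [NormedAddCommGroup F]
    {α q k : ℝ} (hα : α < 0) (hq : 0 < q) (hk : 0 < k) :
    ∃ C : ℝ, 0 ≤ C ∧ ∀ x : F, dampedPower α q k x ≤ C * min (‖x‖ ^ 2) 1 := by
  obtain ⟨n, hn⟩ := exists_nat_ge ((2 - α) / q)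
  set C : ℝ := n.factorial / k ^ n with hC
  have hC0 : 0 ≤ C := by positivity
  refine ⟨C + 1, by positivity, fun x => ?_⟩
  rcases eq_or_ne x 0 with rfl | hx
  · simp [dampedPower, Real.zero_rpow hα.ne]
  have hr : 0 < ‖x‖ := norm_pos_iff.2 hx
  unfold dampedPower
  rcases le_total 1 ‖x‖ with h1 | h1
  · rw [min_eq_right (one_le_pow₀ h1)]
    have ha : ‖x‖ ^ α ≤ 1 := Real.rpow_le_one_of_one_le_of_nonpos h1 hα.le
    have hb : Real.exp (-(k * ‖x‖ ^ (-q))) ≤ 1 := Real.exp_le_one_iff.2 (by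
      have : 0 < k * ‖x‖ ^ (-q) := by positivity
      linarith)
    nlinarith [mul_le_one₀ ha (Real.exp_pos _).le hb]
  · rw [min_eq_left (pow_le_one₀ hr.le h1)]
    set y := ‖x‖ ^ (-q) with hy
    have hy0 : 0 < y := by positivity
    have hy1 : 1 ≤ y := Real.one_le_rpow_of_pos_of_le_one_of_nonpos hr h1 (by linarith)
    have hpow : ‖x‖ ^ α ≤ ‖x‖ ^ 2 * y ^ n := by
      have hle : y ^ ((2 - α) / q) ≤ y ^ n := by
        rw [← Real.rpow_natCast]
        exact Real.rpow_le_rpow_of_exponent_le hy1 hn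
      have heq : ‖x‖ ^ α = ‖x‖ ^ 2 * y ^ ((2 - α) / q) := by
        rw [hy, ← Real.rpow_mul hr.le, ← Real.rpow_natCast, ← Real.rpow_add hr]
        congr 1
        push_cast
        field_simp
        ring
      rw [heq]
      gcongr
    have hexp : y ^ n ≤ C * Real.exp (k * y) := by
      have := Real.pow_div_factorial_le_exp (k * y) (by positivity) n
      rw [mul_pow, div_le_iff₀ (by positivity)] at this
      rw [hC, div_mul_eq_mul_div, le_div_iff₀ (by positivity)]
      linarith
    calc ‖x‖ ^ α * Real.exp (-(k * y))
        ≤ ‖x‖ ^ 2 * (C * Real.exp (k * y)) * Real.exp (-(k * y)) := by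
          gcongr
          exact hpow.trans (by gcongr)
      _ = C * ‖x‖ ^ 2 := by
          rw [Real.exp_neg]
          field_simp
      _ ≤ (C + 1) * ‖x‖ ^ 2 := by nlinarith [sq_nonneg ‖x‖]

theorem IsLevyMeasure.lintegral_dampedPower_lt_top
    {F : Type*} [NormedAddCommGroup F] [MeasurableSpace F] [BorelSpace F]
    {M : Measure F} (hM : IsLevyMeasure M)
    {α q k : ℝ} (hα : α < 0) (hq : 0 < q) (hk : 0 < k) :
    ∫⁻ x, ENNReal.ofReal (dampedPower α q k x) ∂M < ⊤ := by
  obtain ⟨C, hC, hle⟩ := exists_dampedPower_le (F := F) hα hq hk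
  calc ∫⁻ x, ENNReal.ofReal (dampedPower α q k x) ∂M
      ≤ ∫⁻ x, ENNReal.ofReal C * ENNReal.ofReal (min (‖x‖ ^ 2) 1) ∂M :=
        lintegral_mono fun x => by
          rw [← ENNReal.ofReal_mul hC]
          exact ENNReal.ofReal_le_ofReal (hle x)
    _ = ENNReal.ofReal C * ∫⁻ x, ENNReal.ofReal (min (‖x‖ ^ 2) 1) ∂M :=
        lintegral_const_mul _ (by fun_prop)
    _ < ⊤ := ENNReal.mul_lt_top ENNReal.ofReal_lt_top hM.2.2

/-- Lévy measures are determined by the integrals of all damped powers over cones. -/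
theorem IsLevyMeasure.eq_of_setLIntegral_dampedPower_eq [SecondCountableTopology E]
    {M M' : Measure E} (hM : IsLevyMeasure M) (hM' : IsLevyMeasure M') {α q : ℝ}
    (hα : α < 0) (hq : 0 < q)
    (h : ∀ k : ℝ, 0 < k → ∀ A : Set E, MeasurableSet A →
      ∫⁻ x in direction ⁻¹' A, ENNReal.ofReal (dampedPower α q k x) ∂M =
        ∫⁻ x in direction ⁻¹' A, ENNReal.ofReal (dampedPower α q k x) ∂M') : M = M' := by
  set w : E → ENNReal := fun x => ENNReal.ofReal (dampedPower α q 1 x) with hw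
  have hwm : Measurable w := (measurable_dampedPower α q 1).ennreal_ofReal
  set Y : E → ℝ := fun x => ‖x‖ ^ (-q) with hY
  have hYm : Measurable Y := by fun_prop
  have laplace (N : Measure E) {A : Set E} (hA : MeasurableSet A) (t : ℝ) :
      ∫⁻ y, ENNReal.ofReal (Real.exp (t * y))
          ∂(((N.withDensity w).restrict (direction ⁻¹' A)).map Y) =
        ∫⁻ x in direction ⁻¹' A, ENNReal.ofReal (dampedPower α q (1 - t) x) ∂N := by
    rw [lintegral_map (by fun_prop) hYm, restrict_withDensity (measurable_direction hA),
      lintegral_withDensity_eq_lintegral_mul _ hwm (by fun_prop)]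
    refine lintegral_congr fun x => ?_
    rw [Pi.mul_apply, hw, ← ENNReal.ofReal_mul (dampedPower_nonneg _ _ _ _), dampedPower,
      dampedPower, mul_assoc, ← Real.exp_add]
    congr 3
    ring
  have polar_eq : (M.withDensity w).map (fun x => (direction x, Y x)) =
      (M'.withDensity w).map (fun x => (direction x, Y x)) := by
    have hfin : IsFiniteMeasure (M.withDensity w) :=
      isFiniteMeasure_withDensity (hM.lintegral_dampedPower_lt_top hα hq one_pos).ne
    refine Measure.ext_prod fun {A B} hA hB => ?_
    have rect (N : Measure E) : (N.withDensity w).map (fun x => (direction x, Y x)) (A ×ˢ B) =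
        ((N.withDensity w).restrict (direction ⁻¹' A)).map Y B := by
      rw [Measure.map_apply (measurable_direction.prodMk hYm) (hA.prod hB),
        Measure.map_apply hYm hB, Measure.restrict_apply (hYm hB), inter_comm]
      rfl
    rw [rect, rect]
    refine congrArg (fun ν : Measure ℝ => ν B) (measure_eq_of_lintegral_exp_eq one_pos ?_ ?_)
    · intro t ht
      rw [laplace M hA]
      exact (setLIntegral_le_lintegral _ _).trans_lt
        (hM.lintegral_dampedPower_lt_top hα hq (by linarith))
    · intro t ht
      rw [laplace M hA, laplace M' hA, h _ (by linarith) A hA]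
  set U : E × ℝ → E := fun z => z.2 ^ (-q⁻¹) • z.1 with hU
  have hUm : Measurable U := by fun_prop
  have recon (x : E) : U (direction x, Y x) = x := by
    rcases eq_or_ne x 0 with rfl | hx
    · simp [hU, direction]
    have hr : 0 < ‖x‖ := norm_pos_iff.2 hx
    simp only [hU, hY, direction]
    rw [← Real.rpow_mul hr.le, neg_mul_neg, mul_inv_cancel₀ hq.ne', Real.rpow_one, smul_smul,
      mul_inv_cancel₀ hr.ne', one_smul]
  have weighted_eq : M.withDensity w = M'.withDensity w := by
    have := congrArg (Measure.map U) polar_eq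
    rw [Measure.map_map hUm (measurable_direction.prodMk hYm),
      Measure.map_map hUm (measurable_direction.prodMk hYm)] at this
    have hid : U ∘ (fun x => (direction x, Y x)) = id := funext recon
    rwa [hid, Measure.map_id, Measure.map_id] at this
  have unweight {N : Measure E} (hN : N {0} = 0) :
      (N.withDensity w).withDensity w⁻¹ = N := by
    refine withDensity_inv_same hwm ?_ (Filter.Eventually.of_forall fun _ => ENNReal.ofReal_ne_top)
    have : ∀ᵐ x ∂N, x ≠ 0 := by simpa [ae_iff] using hN
    filter_upwards [this] with x hx
    exact (ENNReal.ofReal_pos.2 (dampedPower_pos hx)).ne'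
  rw [← unweight hM.2.1, weighted_eq, unweight hM'.2.1]

theorem stmt13 (d : ℕ) (hd : 1 ≤ d) (α q p : ℝ) (hq : 0 < q) (hqp : q < p) (hα : α < 0)
    (f : ℝ → ℝ) (hf : IsStableDensity (q / p) f) :
    ∀ M ∈ UpsilonDomain (E := EuclideanSpace ℝ (Fin d)) (piMeasure f α p),
      ∀ M' ∈ UpsilonDomain (E := EuclideanSpace ℝ (Fin d)) (piMeasure f α p),
        Upsilon (piMeasure f α p) M = Upsilon (piMeasure f α p) M' → M = M' := by
  rintro M ⟨hM, -⟩ M' ⟨hM', -⟩ heq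
  have hp : 0 < p := hq.trans hqp
  have := hM.1
  have := hM'.1
  refine hM.eq_of_setLIntegral_dampedPower_eq hM' hα hq fun k hk A hA => ?_
  have hroot : (k ^ (p / q)) ^ (q / p) = k := by
    rw [← Real.rpow_mul hk.le, div_mul_div_cancel₀ hq.ne', div_self hp.ne', Real.rpow_one]
  rw [← hroot, ← setLIntegral_upsilon_dampedPower hp hf M (by positivity) hA,
    ← setLIntegral_upsilon_dampedPower hp hf M' (by positivity) hA, heq]
end
end
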